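/- arXiv:0804.0011 — 5 statements merged into one kernel-verified Lean document; each statement's English description precedes it below -/
import Mathlib

section
/- For every even D ≥ 4 there exists a constant C > 0 (depending only on D) with the following property. Let N ≥ 3. Let π₁,…,π_{D/2} be drawn independently and uniformly at random from the symmetric group S_N and set π_{s+D/2} := π_s^{-1} for 1 ≤ s ≤ D/2. Let σ(1),…,σ(D/2) be random diagonal N×N matrices whose diagonal entries are independent uniform ±1 signs, and set σ(s+D/2) := P_{π_s} σ(s) P_{π_s}^{-1}. Define A(s) := (1/√D) P_{π_s} σ(s) and λ := ‖ ∑_{s=1}^D A(s)⊗A(s) − |φ₁⟩⟨φ₁| ‖ (the second largest eigenvalue in absolute value of the associated quantum map). Then for every c > 1, Pr[ λ ≥ c·( λ_H^{1/3} + C·(log log N)/log N ) ] ≤ c^{−3·log N / log(1/λ_H)}, where λ_H := 2√(D−1)/D. -/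
open scoped Kronecker Matrix BigOperators

noncomputable section

/-- The ℓ₂→ℓ₂ operator norm (largest singular value) of a complex matrix. -/
def opNorm {n : Type*} [Fintype n] [DecidableEq n] (A : Matrix n n ℂ) : ℝ :=
  ‖Matrix.toEuclideanCLM (𝕜 := ℂ) A‖

/-- Permutation matrix: entry (i,j) is 1 iff π j = i. -/
def permMat (N : ℕ) (π : Equiv.Perm (Fin N)) : Matrix (Fin N) (Fin N) ℂ :=
  Matrix.of fun i j => if π j = i then 1 else 0

/-- The projection |φ₁⟩⟨φ₁| onto the maximally entangled state. -/
def phi1Proj (N : ℕ) : Matrix (Fin N × Fin N) (Fin N × Fin N) ℂ :=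
  Matrix.of fun p q => if p.1 = p.2 ∧ q.1 = q.2 then (N : ℂ)⁻¹ else 0

/-- λ_H = 2√(D-1)/D. -/
def lamH (D : ℕ) : ℝ := 2 * Real.sqrt ((D : ℝ) - 1) / D

/-- The diagonal ±1 sign matrix σ(s) determined by a Boolean vector. -/
def signDiag (N : ℕ) (b : Fin N → Bool) : Matrix (Fin N) (Fin N) ℂ :=
  Matrix.diagonal fun i => if b i then 1 else -1

/-- Kraus operators A(s) = (1/√D) P_{π_s} σ(s) for s = 1,…,D/2 (`false`), and
A(s+D/2) = A(s)† = (1/√D) σ(s) P_{π_s}⁻¹ (`true`), coming from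
σ(s+D/2) = P_{π_s} σ(s) P_{π_s}⁻¹ and π_{s+D/2} = π_s⁻¹. -/
def Amat (N D : ℕ) (πs : Fin (D / 2) → Equiv.Perm (Fin N))
    (bs : Fin (D / 2) → Fin N → Bool) (p : Fin (D / 2) × Bool) :
    Matrix (Fin N) (Fin N) ℂ :=
  ((Real.sqrt D : ℝ) : ℂ)⁻¹ •
    (if p.2 then signDiag N (bs p.1) * permMat N (πs p.1)⁻¹
     else permMat N (πs p.1) * signDiag N (bs p.1))

/-- The second-largest eigenvalue (in absolute value) of the quantum map with
Kraus operators A(s): the operator norm of ∑_s A(s)⊗A(s) − |φ₁⟩⟨φ₁|. -/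
def lamOf (N D : ℕ) (πs : Fin (D / 2) → Equiv.Perm (Fin N))
    (bs : Fin (D / 2) → Fin N → Bool) : ℝ :=
  opNorm ((∑ p : Fin (D / 2) × Bool, Amat N D πs bs p ⊗ₖ Amat N D πs bs p) - phi1Proj N)

section Exposure

variable {κ V : Type*} [DecidableEq κ] [DecidableEq V]

/-- The formal inverse of a letter. -/
def flipLetter (a : κ × Bool) : κ × Bool := (a.1, !a.2)

/-- The permutation by which a letter acts; `false` stands for the permutation itself and
`true` for its inverse. -/
def act (π : κ → Equiv.Perm V) (a : κ × Bool) : Equiv.Perm V :=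
  if a.2 then (π a.1)⁻¹ else π a.1

omit [DecidableEq κ] [DecidableEq V] in
theorem act_flip (π : κ → Equiv.Perm V) (a : κ × Bool) :
    act π (flipLetter a) = (act π a)⁻¹ := by
  rcases a with ⟨s, β⟩
  cases β <;> simp [act, flipLetter]

omit [DecidableEq κ] [DecidableEq V] in
theorem act_flip_act (π : κ → Equiv.Perm V) (a : κ × Bool) (x : V) :
    act π (flipLetter a) (act π a x) = x := by
  simp [act_flip]

/-- Compose the permutation attached to the letter `a` with a transposition. -/
def switch (π : κ → Equiv.Perm V) (a : κ × Bool) (t z : V) : κ → Equiv.Perm V :=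
  Function.update π a.1
    (if a.2 then π a.1 * Equiv.swap t z else Equiv.swap t z * π a.1)

theorem act_switch_self (π : κ → Equiv.Perm V) (a : κ × Bool) (t z : V) :
    act (switch π a t z) a = Equiv.swap t z * act π a := by
  rcases a with ⟨s, β⟩
  cases β <;> simp [act, switch]

theorem act_switch_flip (π : κ → Equiv.Perm V) (a : κ × Bool) (t z : V) :
    act (switch π a t z) (flipLetter a) = act π (flipLetter a) * Equiv.swap t z := by
  simp [act_flip, act_switch_self]

theorem act_switch_of_ne (π : κ → Equiv.Perm V) {a b : κ × Bool} (h : b ≠ a)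
    (h' : b ≠ flipLetter a) (t z : V) : act (switch π a t z) b = act π b := by
  rcases a with ⟨s, β⟩
  rcases b with ⟨s', β'⟩
  have : s' ≠ s := by
    rintro rfl
    cases β <;> cases β' <;> simp_all [flipLetter]
  simp [act, switch, Function.update_of_ne this]

theorem switch_switch (π : κ → Equiv.Perm V) (a : κ × Bool) (t z : V) :
    switch (switch π a t z) a t z = π := by
  rcases a with ⟨s, β⟩
  cases β <;> simp [switch, mul_assoc, ← mul_assoc (Equiv.swap t z)]

/-- `π'` sends the first `n` sources of the exploration of `π` to the same targets. -/
def Agree (a : ℕ → κ × Bool) (src : (κ → Equiv.Perm V) → ℕ → V)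
    (π π' : κ → Equiv.Perm V) (n : ℕ) : Prop :=
  ∀ q < n, act π' (a q) (src π q) = act π (a q) (src π q)

/-- The `n`-th source only depends on the first `n` explored edges. -/
def IsLocal (a : ℕ → κ × Bool) (src : (κ → Equiv.Perm V) → ℕ → V) : Prop :=
  ∀ π π' n, Agree a src π π' n → src π' n = src π n

/-- The edge explored at time `n` has not been explored before. -/
def FreeStep (a : ℕ → κ × Bool) (src : (κ → Equiv.Perm V) → ℕ → V)
    (π : κ → Equiv.Perm V) (n : ℕ) : Prop :=
  ∀ q < n, ¬ (a q = a n ∧ src π q = src π n) ∧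
    ¬ (a q = flipLetter (a n) ∧ act π (a q) (src π q) = src π n)

/-- The edge explored at time `n` is new, but leads to a vertex in `X` or to an earlier target. -/
def Coincidence (a : ℕ → κ × Bool) (src : (κ → Equiv.Perm V) → ℕ → V) (X : Finset V)
    (π : κ → Equiv.Perm V) (n : ℕ) : Prop :=
  FreeStep a src π n ∧ (act π (a n) (src π n) ∈ X ∨
    ∃ q < n, act π (a n) (src π n) = act π (a q) (src π q))

variable {a : ℕ → κ × Bool} {src : (κ → Equiv.Perm V) → ℕ → V}

omit [DecidableEq κ] [DecidableEq V] in
theorem Agree.mono {π π' : κ → Equiv.Perm V} {m n : ℕ} (h : Agree a src π π' n) (hmn : m ≤ n) :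
    Agree a src π π' m := fun q hq => h q (hq.trans_le hmn)

omit [DecidableEq κ] [DecidableEq V] in
theorem IsLocal.tgt_eq (hl : IsLocal a src) {π π' : κ → Equiv.Perm V} {n q : ℕ}
    (h : Agree a src π π' n) (hq : q < n) :
    act π' (a q) (src π' q) = act π (a q) (src π q) := by
  rw [hl π π' q (h.mono hq.le), h q hq]

omit [DecidableEq κ] [DecidableEq V] in
theorem IsLocal.freeStep (hl : IsLocal a src) {π π' : κ → Equiv.Perm V} {n : ℕ}
    (h : Agree a src π π' n) (hF : FreeStep a src π n) : FreeStep a src π' n := by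
  intro q hq
  rw [hl.tgt_eq h hq, hl π π' n h, hl π π' q (h.mono hq.le)]
  exact hF q hq

omit [DecidableEq κ] [DecidableEq V] in
theorem IsLocal.coincidence (hl : IsLocal a src) {X : Finset V} {π π' : κ → Equiv.Perm V} {m n : ℕ}
    (h : Agree a src π π' n) (hmn : m < n) (hC : Coincidence a src X π m) :
    Coincidence a src X π' m := by
  refine ⟨hl.freeStep (h.mono hmn.le) hC.1, ?_⟩
  rw [hl.tgt_eq h hmn]
  refine hC.2.imp id ?_
  rintro ⟨q, hq, e⟩
  exact ⟨q, hq, by rw [e, hl.tgt_eq h (hq.trans hmn)]⟩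

theorem agree_switch {π : κ → Equiv.Perm V} {n : ℕ} (hF : FreeStep a src π n) {z : V}
    (hz : ∀ q < n, src π q ≠ z ∧ act π (a q) (src π q) ≠ z) :
    Agree a src π (switch π (a n) (act π (a n) (src π n)) z) n := by
  intro q hq
  obtain ⟨h1, h2⟩ := hF q hq
  obtain ⟨z1, z2⟩ := hz q hq
  by_cases e1 : a q = a n
  · have : act π (a q) (src π q) ≠ act π (a n) (src π n) := by
      rw [e1]
      exact fun h => h1 ⟨e1, (act π (a n)).injective h⟩
    rw [e1] at this z2 ⊢
    rw [act_switch_self, Equiv.Perm.mul_apply, Equiv.swap_apply_of_ne_of_ne this z2]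
  by_cases e2 : a q = flipLetter (a n)
  · have : src π q ≠ act π (a n) (src π n) := by
      intro h
      refine h2 ⟨e2, ?_⟩
      rw [h, e2, act_flip_act]
    rw [e2, act_switch_flip, Equiv.Perm.mul_apply, Equiv.swap_apply_of_ne_of_ne this z1]
  · rw [act_switch_of_ne π e1 e2]

open Classical in
theorem card_freeStep_tgt_eq_le [Fintype κ] [Fintype V] (hl : IsLocal a src) {n : ℕ}
    (B : Finset (κ → Equiv.Perm V))
    (hB : ∀ π ∈ B, ∀ π', Agree a src π π' n → π' ∈ B) (τ : (κ → Equiv.Perm V) → V)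
    (hτ : ∀ π π', Agree a src π π' n → τ π' = τ π) :
    (Fintype.card V - 2 * n) *
      (B.filter fun π => FreeStep a src π n ∧ act π (a n) (src π n) = τ π).card ≤ B.card := by
  set S := B.filter fun π => FreeStep a src π n ∧ act π (a n) (src π n) = τ π with hS
  let known : (κ → Equiv.Perm V) → Finset V := fun π =>
    (Finset.range n).image (src π) ∪ (Finset.range n).image fun q => act π (a q) (src π q)
  have hknown : ∀ π, (known π).card ≤ 2 * n := by
    intro π
    refine (Finset.card_union_le _ _).trans ?_
    have h1 := Finset.card_image_le (s := Finset.range n) (f := src π)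
    have h2 := Finset.card_image_le (s := Finset.range n) (f := fun q => act π (a q) (src π q))
    rw [Finset.card_range] at h1 h2
    omega
  have hfresh : ∀ π, ∀ z ∈ (known π)ᶜ, ∀ q < n, src π q ≠ z ∧ act π (a q) (src π q) ≠ z := by
    intro π z hz q hq
    simp only [known, Finset.mem_compl, Finset.mem_union, Finset.mem_image, Finset.mem_range,
      not_or, not_exists, not_and] at hz
    exact ⟨hz.1 q hq, hz.2 q hq⟩
  calc (Fintype.card V - 2 * n) * S.card = ∑ π ∈ S, (Fintype.card V - 2 * n) := by
        rw [Finset.sum_const, smul_eq_mul, mul_comm]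
    _ ≤ ∑ π ∈ S, ((known π)ᶜ).card := by
        refine Finset.sum_le_sum fun π _ => ?_
        rw [Finset.card_compl]
        exact Nat.sub_le_sub_left (hknown π) _
    _ = (S.sigma fun π => (known π)ᶜ).card := (Finset.card_sigma _ _).symm
    _ ≤ B.card := by
        refine Finset.card_le_card_of_injOn
          (fun p => switch p.1 (a n) (act p.1 (a n) (src p.1 n)) p.2) ?_ ?_
        · rintro ⟨π, z⟩ hp
          simp only [Finset.coe_sigma, Set.mem_sigma_iff, Finset.mem_coe, hS,
            Finset.mem_filter] at hp
          exact hB π hp.1.1 _ (agree_switch hp.1.2.1 (hfresh π z hp.2))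
        · rintro ⟨π, z⟩ hp ⟨π', z'⟩ hp' heq
          simp only [Finset.coe_sigma, Set.mem_sigma_iff, Finset.mem_coe, hS,
            Finset.mem_filter] at hp hp'
          have key : ∀ (π : κ → Equiv.Perm V) (z : V), FreeStep a src π n →
              act π (a n) (src π n) = τ π → z ∈ (known π)ᶜ →
              ∀ ρ, ρ = switch π (a n) (act π (a n) (src π n)) z →
              z = act ρ (a n) (src ρ n) ∧ π = switch ρ (a n) (τ ρ) (act ρ (a n) (src ρ n)) := by
            intro π z hF ht hz ρ hρ
            have hA : Agree a src π ρ n := hρ ▸ agree_switch hF (hfresh π z hz)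
            have h1 : z = act ρ (a n) (src ρ n) := by
              rw [hl π ρ n hA, hρ, act_switch_self]
              simp
            refine ⟨h1, ?_⟩
            rw [← h1, hτ π ρ hA, ← ht, hρ, switch_switch]
          obtain ⟨k1, k2⟩ := key π z hp.1.2.1 hp.1.2.2 hp.2 _ rfl
          obtain ⟨k1', k2'⟩ := key π' z' hp'.1.2.1 hp'.1.2.2 hp'.2 _ heq
          have e1 : z = z' := k1.trans k1'.symm
          have e2 : π = π' := k2.trans k2'.symm
          subst e1 e2
          rfl

open Classical in
theorem card_coincidence_le [Fintype κ] [Fintype V] (hl : IsLocal a src) {n : ℕ} (X : Finset V)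
    (B : Finset (κ → Equiv.Perm V))
    (hB : ∀ π ∈ B, ∀ π', Agree a src π π' n → π' ∈ B) :
    (Fintype.card V - 2 * n) * (B.filter fun π => Coincidence a src X π n).card ≤
      (X.card + n) * B.card := by
  have hsub : (B.filter fun π => Coincidence a src X π n) ⊆
      (X.biUnion fun x => B.filter fun π =>
        FreeStep a src π n ∧ act π (a n) (src π n) = x) ∪
      ((Finset.range n).biUnion fun q => B.filter fun π =>
        FreeStep a src π n ∧ act π (a n) (src π n) = act π (a q) (src π q)) := by
    intro π hπ
    simp only [Finset.mem_filter, Finset.mem_union, Finset.mem_biUnion, Finset.mem_range] at hπ ⊢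
    obtain ⟨hπB, hF, h | ⟨q, hq, h⟩⟩ := hπ
    · exact Or.inl ⟨_, h, hπB, hF, rfl⟩
    · exact Or.inr ⟨q, hq, hπB, hF, h⟩
  calc _ ≤ (Fintype.card V - 2 * n) *
        (∑ x ∈ X, (B.filter fun π => FreeStep a src π n ∧ act π (a n) (src π n) = x).card +
        ∑ q ∈ Finset.range n, (B.filter fun π =>
          FreeStep a src π n ∧ act π (a n) (src π n) = act π (a q) (src π q)).card) :=
        Nat.mul_le_mul_left _ ((Finset.card_le_card hsub).trans
          ((Finset.card_union_le _ _).trans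
            (add_le_add Finset.card_biUnion_le Finset.card_biUnion_le)))
    _ = ∑ x ∈ X, (Fintype.card V - 2 * n) *
          (B.filter fun π => FreeStep a src π n ∧ act π (a n) (src π n) = x).card +
        ∑ q ∈ Finset.range n, (Fintype.card V - 2 * n) * (B.filter fun π =>
          FreeStep a src π n ∧ act π (a n) (src π n) = act π (a q) (src π q)).card := by
        rw [mul_add, Finset.mul_sum, Finset.mul_sum]
    _ ≤ ∑ x ∈ X, B.card + ∑ q ∈ Finset.range n, B.card := by
        refine add_le_add (Finset.sum_le_sum fun x _ => ?_) (Finset.sum_le_sum fun q hq => ?_)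
        · exact card_freeStep_tgt_eq_le hl B hB (fun _ => x) fun _ _ _ => rfl
        · exact card_freeStep_tgt_eq_le hl B hB (fun π => act π (a q) (src π q))
            fun π π' h => hl.tgt_eq h (Finset.mem_range.1 hq)
    _ = (X.card + n) * B.card := by
        simp [add_mul]

open Classical in
theorem card_coincidence_le_real [Fintype κ] [Fintype V] (hl : IsLocal a src) {n M : ℕ}
    (hn : n < M) (hM : 2 * M < Fintype.card V) (X : Finset V) (hX : X.card ≤ 2)
    (B : Finset (κ → Equiv.Perm V))
    (hB : ∀ π ∈ B, ∀ π', Agree a src π π' n → π' ∈ B) :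
    ((B.filter fun π => Coincidence a src X π n).card : ℝ) ≤
      ((M + 2) / (Fintype.card V - 2 * M) : ℝ) * B.card := by
  have h := card_coincidence_le hl X B hB
  have h' : (Fintype.card V - 2 * M) * (B.filter fun π => Coincidence a src X π n).card ≤
      (M + 2) * B.card :=
    (Nat.mul_le_mul_right _ (by omega)).trans (h.trans (Nat.mul_le_mul_right _ (by omega)))
  have hpos : (0 : ℝ) < Fintype.card V - 2 * M := by
    have : ((2 * M : ℕ) : ℝ) < Fintype.card V := by exact_mod_cast hM
    push_cast at this
    linarith
  rw [div_mul_eq_mul_div, le_div_iff₀ hpos, mul_comm]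
  have := (Nat.cast_le (α := ℝ)).2 h'
  rw [Nat.cast_mul, Nat.cast_sub hM.le] at this
  push_cast at this
  exact this

open Classical in
theorem card_two_coincidences_le [Fintype κ] [Fintype V] (hl : IsLocal a src) {n₁ n₂ M : ℕ}
    (h12 : n₁ < n₂) (hn : n₂ < M) (hM : 2 * M < Fintype.card V) (X : Finset V)
    (hX : X.card ≤ 2) :
    ((Finset.univ.filter fun π : κ → Equiv.Perm V =>
      Coincidence a src X π n₁ ∧ Coincidence a src X π n₂).card : ℝ) ≤
      ((M + 2) / (Fintype.card V - 2 * M) : ℝ) ^ 2 * Fintype.card (κ → Equiv.Perm V) := by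
  have hpos : (0 : ℝ) ≤ ((M + 2) / (Fintype.card V - 2 * M) : ℝ) := by
    have : ((2 * M : ℕ) : ℝ) < Fintype.card V := by exact_mod_cast hM
    push_cast at this
    exact div_nonneg (by positivity) (by linarith)
  rw [← Finset.filter_filter]
  refine (card_coincidence_le_real hl hn hM X hX _ ?_).trans ?_
  · intro π hπ π' hA
    simp only [Finset.mem_filter, Finset.mem_univ, true_and] at hπ ⊢
    exact hl.coincidence hA h12 hπ
  · rw [pow_two, mul_assoc]
    exact mul_le_mul_of_nonneg_left
      (card_coincidence_le_real hl (h12.trans hn) hM X hX _ fun _ _ _ _ => Finset.mem_univ _) hpos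

open Classical in
theorem card_three_coincidences_le [Fintype κ] [Fintype V] (hl : IsLocal a src) {n₁ n₂ n₃ M : ℕ}
    (h12 : n₁ < n₂) (h23 : n₂ < n₃) (hn : n₃ < M) (hM : 2 * M < Fintype.card V) (X : Finset V)
    (hX : X.card ≤ 2) :
    ((Finset.univ.filter fun π : κ → Equiv.Perm V =>
      (Coincidence a src X π n₁ ∧ Coincidence a src X π n₂) ∧ Coincidence a src X π n₃).card : ℝ) ≤
      ((M + 2) / (Fintype.card V - 2 * M) : ℝ) ^ 3 * Fintype.card (κ → Equiv.Perm V) := by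
  have hpos : (0 : ℝ) ≤ ((M + 2) / (Fintype.card V - 2 * M) : ℝ) := by
    have : ((2 * M : ℕ) : ℝ) < Fintype.card V := by exact_mod_cast hM
    push_cast at this
    exact div_nonneg (by positivity) (by linarith)
  rw [← Finset.filter_filter]
  refine (card_coincidence_le_real hl hn hM X hX _ ?_).trans ?_
  · intro π hπ π' hA
    simp only [Finset.mem_filter, Finset.mem_univ, true_and] at hπ ⊢
    exact ⟨hl.coincidence hA (h12.trans h23) hπ.1, hl.coincidence hA h23 hπ.2⟩
  · rw [pow_succ', mul_assoc]
    exact mul_le_mul_of_nonneg_left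
      (card_two_coincidences_le hl h12 (h23.trans hn) hM X hX) hpos

end Exposure

section Walks

variable {κ V : Type*} [DecidableEq κ] [DecidableEq V]

omit [DecidableEq κ] in
@[simp] theorem flipLetter_flipLetter (a : κ × Bool) : flipLetter (flipLetter a) = a := by
  simp [flipLetter]

omit [DecidableEq κ] in
theorem ne_flipLetter (a : κ × Bool) : a ≠ flipLetter a := by
  rcases a with ⟨s, β⟩
  cases β <;> simp [flipLetter]

/-- The position after `n` steps of the walk from `x` reading the letters `a 0, a 1, …`. -/
def walk (π : κ → Equiv.Perm V) (a : ℕ → κ × Bool) (x : V) : ℕ → V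
  | 0 => x
  | n + 1 => act π (a n) (walk π a x n)

/-- An infinite word of period `l` that is reduced, and such that its first `l` letters are not
periodic with a proper divisor of `l` as a period. -/
structure IsPrimitiveWord (a : ℕ → κ × Bool) (l : ℕ) : Prop where
  pos : 0 < l
  periodic : ∀ n, a (n + l) = a n
  reduced : ∀ n, a (n + 1) ≠ flipLetter (a n)
  primitive : ∀ T, T ∣ l → T < l → ∃ n < l, a n ≠ a (n % T)

variable {a : ℕ → κ × Bool} {l : ℕ} {π : κ → Equiv.Perm V}

omit [DecidableEq κ] [DecidableEq V] in
theorem IsPrimitiveWord.mod_eq (ha : IsPrimitiveWord a l) (n : ℕ) : a (n % l) = a n :=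
  Function.Periodic.map_mod_nat ha.periodic n

omit [DecidableEq κ] [DecidableEq V] in
theorem IsPrimitiveWord.not_shift (ha : IsPrimitiveWord a l) {s : ℕ} (hs : 0 < s) (hsl : s < l) :
    ¬ ∀ n, a (n + s) = a n := by
  intro h
  have hg : Nat.gcd s l < l := (Nat.gcd_le_left l hs).trans_lt hsl
  obtain ⟨m, -, hm⟩ := Nat.exists_mul_mod_eq_gcd hg
  have hper : Function.Periodic a s := h
  have hT : Function.Periodic a (Nat.gcd s l) := by
    intro n
    have h1 : a (n + s * m) = a n := by
      have := hper.nat_mul m n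
      rwa [Nat.cast_id, mul_comm] at this
    rw [← h1, ← ha.mod_eq (n + s * m), ← ha.mod_eq (n + Nat.gcd s l), ← hm]
    simp
  obtain ⟨n, -, hn⟩ := ha.primitive _ (Nat.gcd_dvd_right s l) hg
  exact hn (hT.map_mod_nat n).symm

omit [DecidableEq κ] [DecidableEq V] in
theorem walk_add_period (ha : IsPrimitiveWord a l) {x : V} (hc : walk π a x l = x) (n : ℕ) :
    walk π a x (n + l) = walk π a x n := by
  induction n with
  | zero => simpa [walk] using hc
  | succ n ih => rw [Nat.add_right_comm, walk, walk, ih, ha.periodic]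

omit [DecidableEq κ] [DecidableEq V] in
theorem walk_mod (ha : IsPrimitiveWord a l) {x : V} (hc : walk π a x l = x) (n : ℕ) :
    walk π a x (n % l) = walk π a x n :=
  Function.Periodic.map_mod_nat (walk_add_period ha hc) n

omit [DecidableEq κ] [DecidableEq V] in
/-- After a free step, a reduced walk without coincidences only makes free steps. -/
theorem freeStep_of_no_coincidence {src : (κ → Equiv.Perm V) → ℕ → V} {X : Finset V} {s e : ℕ}
    (hred : ∀ n, a (n + 1) ≠ flipLetter (a n))
    (hsrc : ∀ q < e, src π q ∈ X ∨ ∃ q' < q, src π q = act π (a q') (src π q'))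
    (hstep : ∀ n, s ≤ n → n + 1 < e → src π (n + 1) = act π (a n) (src π n))
    (hno : ∀ n, s ≤ n → n < e → ¬ Coincidence a src X π n)
    (hF : FreeStep a src π s) (n : ℕ) (hsn : s ≤ n) (hne : n < e) : FreeStep a src π n := by
  induction n, hsn using Nat.le_induction with
  | base => exact hF
  | succ n hsn ih =>
    have hFn := ih (by omega)
    have hnew := hno n hsn (by omega)
    simp only [Coincidence, hFn, true_and, not_or, not_exists, not_and] at hnew
    obtain ⟨hX, hT⟩ := hnew
    intro q hq
    rw [hstep n hsn hne]
    constructor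
    · rintro ⟨-, h⟩
      rcases hsrc q (by omega) with h' | ⟨q', hq', h'⟩
      · exact hX (h ▸ h')
      · exact hT q' (by omega) (h.symm.trans h')
    · rintro ⟨h1, h2⟩
      rcases Nat.lt_succ_iff_lt_or_eq.1 hq with h | rfl
      · exact hT q h h2.symm
      · apply hred q
        rw [h1, flipLetter_flipLetter]

omit [DecidableEq κ] [DecidableEq V] in
theorem walk_mem_or (x : V) (q : ℕ) : walk π a x q ∈ ({x} : Finset V) ∨
    ∃ q' < q, walk π a x q = act π (a q') (walk π a x q') := by
  cases q with
  | zero => left; simp [walk]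
  | succ q => right; exact ⟨q, by omega, rfl⟩

omit [DecidableEq κ] in
/-- A closed walk along a primitive word is either a simple cycle or has two coincidences. -/
theorem exists_two_coincidences (ha : IsPrimitiveWord a l) {x : V} (hc : walk π a x l = x)
    (hns : ¬ ∀ m < l, ∀ n < l, walk π a x m = walk π a x n → m = n) :
    ∃ n₁ n₂, n₁ < n₂ ∧ n₂ < l ∧ Coincidence a (fun π => walk π a x) {x} π n₁ ∧
      Coincidence a (fun π => walk π a x) {x} π n₂ := by
  classical
  set P := walk π a x with hP
  have hP0 : P 0 = x := rfl
  have hPs : ∀ n, P (n + 1) = act π (a n) (P n) := fun n => rfl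
  have hex : ∃ t, t < l ∧ ∃ s ≤ t, P (t + 1) = P s :=
    ⟨l - 1, by have := ha.pos; omega, 0, by omega, by
      rw [Nat.sub_add_cancel ha.pos, hc, hP0]⟩
  set t := Nat.find hex with ht
  obtain ⟨htl, s, hst, hts⟩ := Nat.find_spec hex
  rw [← ht] at htl hst hts
  have hmin : ∀ r < t, ∀ s ≤ r, P (r + 1) ≠ P s := by
    intro r hr s hs h
    exact Nat.find_min hex hr ⟨by omega, s, hs, h⟩
  have hdist : ∀ m ≤ t, ∀ n ≤ t, P m = P n → m = n := by
    have : ∀ m n, m < n → n ≤ t → P m ≠ P n := by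
      intro m n hmn hn h
      obtain ⟨r, rfl⟩ : ∃ r, n = r + 1 := ⟨n - 1, by omega⟩
      exact hmin r (by omega) m (by omega) h.symm
    intro m hm n hn h
    rcases lt_trichotomy m n with h' | h' | h'
    · exact absurd h (this m n h' hn)
    · exact h'
    · exact absurd h.symm (this n m h' hm)
  have hFt : FreeStep a (fun π => walk π a x) π t := by
    intro q hq
    refine ⟨fun h => ?_, fun h => ?_⟩
    · exact absurd (hdist q hq.le t le_rfl h.2) hq.ne
    · have := hdist (q + 1) hq t le_rfl h.2
      apply ha.reduced q
      rw [h.1, this, flipLetter_flipLetter]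
  have hcoin : Coincidence a (fun π => walk π a x) {x} π t := by
    refine ⟨hFt, ?_⟩
    rcases Nat.eq_zero_or_pos s with rfl | hs
    · left
      rw [Finset.mem_singleton]
      exact hts
    · right
      obtain ⟨r, rfl⟩ : ∃ r, s = r + 1 := ⟨s - 1, by omega⟩
      exact ⟨r, by omega, hts⟩
  by_contra hcon
  have hno : ∀ n, t < n → n < l → ¬ Coincidence a (fun π => walk π a x) {x} π n :=
    fun n h1 h2 h3 => hcon ⟨t, n, h1, h2, hcoin, h3⟩
  have htl' : t + 1 < l := by
    by_contra h
    have : t + 1 = l := by omega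
    exact hns fun m hm n hn h => hdist m (by omega) n (by omega) h
  have hforced : ∀ n, t < n → n < l → ¬ FreeStep a (fun π => walk π a x) π n := by
    intro n h1 h2 hF
    have h3 := freeStep_of_no_coincidence (X := {x}) (s := n) (e := l) ha.reduced
      (fun q _ => walk_mem_or x q) (fun _ _ _ => rfl)
      (fun m hm hml => hno m (by omega) hml) hF (l - 1) (by omega) (by omega)
    refine hno (l - 1) (by omega) (by omega) ⟨h3, Or.inl ?_⟩
    have : P (l - 1 + 1) = x := by rw [Nat.sub_add_cancel ha.pos, hc]
    rw [Finset.mem_singleton]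
    exact this
  have hold : ∀ n, t < n → n < l → ∃ q ≤ t, (a q = a n ∧ P q = P n) ∨
      (a q = flipLetter (a n) ∧ P (q + 1) = P n ∧ P q = P (n + 1)) := by
    intro n
    induction n using Nat.strong_induction_on with
    | _ n ih =>
      intro h1 h2
      have := hforced n h1 h2
      simp only [FreeStep, not_forall] at this
      obtain ⟨q, hq, h⟩ := this
      rw [← not_or, not_not] at h
      have h' : (a q = a n ∧ P q = P n) ∨
          (a q = flipLetter (a n) ∧ P (q + 1) = P n ∧ P q = P (n + 1)) := by
        refine h.imp id ?_
        rintro ⟨e1, e2⟩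
        refine ⟨e1, e2, ?_⟩
        have e3 : P (q + 1) = P n := e2
        have e4 : a n = flipLetter (a q) := by rw [e1, flipLetter_flipLetter]
        rw [hPs n, ← e3, hPs q, e4, act_flip_act]
      rcases le_or_gt q t with hqt | hqt
      · exact ⟨q, hqt, h'⟩
      · obtain ⟨r, hr, hrq⟩ := ih q hq hqt (by omega)
        refine ⟨r, hr, ?_⟩
        rcases h' with ⟨e1, e2⟩ | ⟨e1, e2, e3⟩
        · have e3 : P (q + 1) = P (n + 1) := by rw [hPs, hPs, e1, e2]
          rw [← e1, ← e2, ← e3]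
          exact hrq
        · rcases hrq with ⟨f1, f2⟩ | ⟨f1, f2, f3⟩
          · right
            refine ⟨f1.trans e1, ?_, f2.trans e3⟩
            rw [hPs, f1, f2, ← hPs, e2]
          · left
            refine ⟨by rw [f1, e1, flipLetter_flipLetter], by rw [f3, e2]⟩
  rcases Nat.eq_zero_or_pos s with rfl | hs
  · have hall : ∀ n ≤ l, P n = P (n % (t + 1)) ∧ (n < l → a n = a (n % (t + 1))) := by
      have hPmod : ∀ n, P n = P (n % (t + 1)) → a n = a (n % (t + 1)) →
          P (n + 1) = P ((n + 1) % (t + 1)) := by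
        intro n h1 h2
        have h3 : P (n + 1) = P (n % (t + 1) + 1) := by rw [hPs, hPs, ← h1, ← h2]
        have h4 : n % (t + 1) < t + 1 := Nat.mod_lt _ (by omega)
        rcases Nat.lt_or_ge (n % (t + 1) + 1) (t + 1) with h5 | h5
        · rw [h3]
          congr 1
          rw [Nat.add_mod n 1, Nat.mod_eq_of_lt (a := 1) (by omega), Nat.mod_eq_of_lt h5]
        · have h6 : n % (t + 1) + 1 = t + 1 := by omega
          have h7 : (n + 1) % (t + 1) = 0 := by
            rw [Nat.add_mod]
            rcases Nat.eq_zero_or_pos t with h0 | h0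
            · simp [h0, Nat.mod_one]
            · rw [Nat.mod_eq_of_lt (a := 1) (by omega), h6, Nat.mod_self]
          rw [h3, h6, h7, hts]
      intro n
      induction n with
      | zero => intro _; simp
      | succ n ih =>
        intro hn
        obtain ⟨i1, i2⟩ := ih (by omega)
        have i2 := i2 (by omega)
        have h1 := hPmod n i1 i2
        refine ⟨h1, fun hn' => ?_⟩
        rcases Nat.lt_or_ge n t with hnt | hnt
        · rw [Nat.mod_eq_of_lt (by omega : n + 1 < t + 1)]
        have hr : (n + 1) % (t + 1) < t + 1 := Nat.mod_lt _ (by omega)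
        obtain ⟨q, hq, ⟨e1, e2⟩ | ⟨e1, e2, e3⟩⟩ := hold (n + 1) (by omega) hn'
        · rw [h1] at e2
          rw [← hdist q hq _ (by omega) e2, e1]
        · exfalso
          rw [h1] at e2
          have hq' : q = n % (t + 1) := by
            have hnm : (n + 1) % (t + 1) = (n % (t + 1) + 1) % (t + 1) := by
              simp [Nat.add_mod]
            have h4 : n % (t + 1) < t + 1 := Nat.mod_lt _ (by omega)
            have aux : ∀ u ≤ t, P (u + 1) = P ((u + 1) % (t + 1)) := by
              intro u hu
              rcases Nat.lt_or_ge u t with h | h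
              · rw [Nat.mod_eq_of_lt (by omega : u + 1 < t + 1)]
              · have : u = t := by omega
                rw [this, Nat.mod_self, hts]
            have h5 : (q + 1) % (t + 1) = (n % (t + 1) + 1) % (t + 1) := by
              rw [← hnm]
              refine hdist _ ?_ _ (by omega) ?_
              · have := Nat.mod_lt (q + 1) (by omega : 0 < t + 1); omega
              · rw [← aux q hq, e2]
            have h6 : (q + 1) ≡ (n % (t + 1) + 1) [MOD t + 1] := h5
            have h7 := Nat.ModEq.add_right_cancel' 1 h6
            have h8 : q % (t + 1) = n % (t + 1) % (t + 1) := h7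
            rwa [Nat.mod_eq_of_lt (by omega : q < t + 1), Nat.mod_mod] at h8
          apply ha.reduced n
          rw [i2, ← hq', e1, flipLetter_flipLetter]
    have hdvd : t + 1 ∣ l := by
      have h1 := (hall l le_rfl).1
      have h2 : l % (t + 1) < t + 1 := Nat.mod_lt _ (by omega)
      have h3 : P 0 = P (l % (t + 1)) := by rw [← h1, hc, hP0]
      exact Nat.dvd_of_mod_eq_zero (hdist 0 (by omega) _ (by omega) h3).symm
    obtain ⟨n, hn, hne⟩ := ha.primitive _ hdvd htl'
    exact hne ((hall n hn.le).2 hn)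
  · have hlast : P (l - 1 + 1) = P 0 := by rw [Nat.sub_add_cancel ha.pos, hc, hP0]
    obtain ⟨q, hq, ⟨e1, e2⟩ | ⟨e1, e2, e3⟩⟩ := hold (l - 1) (by omega) (by omega)
    · have h1 : P (q + 1) = P 0 := by rw [hPs, e1, e2, ← hPs, hlast]
      rcases Nat.lt_or_ge q t with h | h
      · have := hdist _ (by omega) _ (by omega) h1
        omega
      · have : q = t := by omega
        rw [this, hts] at h1
        have := hdist _ hst _ (by omega) h1
        omega
    · rw [hlast] at e3
      have h0 := hdist _ hq _ (by omega) e3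
      subst h0
      apply ha.reduced (l - 1)
      have := ha.periodic 0
      rw [Nat.sub_add_cancel ha.pos, ← zero_add l, this, e1, zero_add]

end Walks

section PairWalks

variable {κ V : Type*} [DecidableEq κ] [DecidableEq V]
variable {a : ℕ → κ × Bool} {l : ℕ} {π : κ → Equiv.Perm V}

/-- The sources explored by first walking `l` steps from `i` and then `l` steps from `j`. -/
def pairSrc (a : ℕ → κ × Bool) (l : ℕ) (i j : V) (π : κ → Equiv.Perm V) (n : ℕ) : V :=
  if n < l then walk π a i n else walk π a j (n - l)

omit [DecidableEq κ] [DecidableEq V] in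
theorem pairSrc_add (i j : V) (n : ℕ) : pairSrc a l i j π (l + n) = walk π a j n := by
  simp [pairSrc]

omit [DecidableEq κ] [DecidableEq V] in
theorem pairSrc_of_lt (i j : V) {n : ℕ} (h : n < l) : pairSrc a l i j π n = walk π a i n := by
  simp [pairSrc, h]

omit [DecidableEq κ] [DecidableEq V] in
theorem isLocal_walk (i : V) : IsLocal a (fun π => walk π a i) := by
  intro π π' n h
  change walk π' a i n = walk π a i n
  induction n with
  | zero => rfl
  | succ n ih =>
    rw [walk, walk, ih (h.mono n.le_succ)]
    exact h n (Nat.lt_succ_self n)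

omit [DecidableEq κ] [DecidableEq V] in
theorem isLocal_pairSrc (hper : ∀ n, a (n + l) = a n) (i j : V) :
    IsLocal a (pairSrc a l i j) := by
  intro π π' n h
  rcases Nat.lt_or_ge n l with hn | hn
  · rw [pairSrc_of_lt i j hn, pairSrc_of_lt i j hn]
    refine isLocal_walk i π π' n fun q hq => ?_
    have := h q hq
    rwa [pairSrc_of_lt i j (hq.trans hn)] at this
  · obtain ⟨m, rfl⟩ := Nat.exists_eq_add_of_le hn
    rw [pairSrc_add, pairSrc_add]
    refine isLocal_walk j π π' m fun q hq => ?_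
    have := h (l + q) (by omega)
    rwa [pairSrc_add, add_comm l q, hper] at this

omit [DecidableEq κ] in
theorem coincidence_pairSrc_of_walk {i j : V} {n : ℕ} (hn : n < l)
    (h : Coincidence a (fun π => walk π a i) {i} π n) :
    Coincidence a (pairSrc a l i j) {i, j} π n := by
  obtain ⟨hF, hT⟩ := h
  refine ⟨fun q hq => ?_, ?_⟩
  · rw [pairSrc_of_lt i j hn, pairSrc_of_lt i j (hq.trans hn)]
    exact hF q hq
  · rw [pairSrc_of_lt i j hn]
    refine hT.imp (fun h => ?_) ?_
    · rw [Finset.mem_singleton] at h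
      exact Finset.mem_insert.2 (Or.inl h)
    · rintro ⟨q, hq, e⟩
      exact ⟨q, hq, by rwa [pairSrc_of_lt i j (hq.trans hn)]⟩

omit [DecidableEq κ] in
/-- A closed walk from a vertex that the first walk misses creates a further coincidence. -/
theorem exists_coincidence_second (ha : IsPrimitiveWord a l) {i j : V}
    (hc : walk π a j l = j) (hj : ∀ q ≤ l, walk π a i q ≠ j) :
    ∃ n, l ≤ n ∧ n < 2 * l ∧ Coincidence a (pairSrc a l i j) {i, j} π n := by
  by_contra hcon
  have hpos := ha.pos
  have htgt : ∀ n, act π (a (l + n)) (pairSrc a l i j π (l + n)) = walk π a j (n + 1) := by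
    intro n
    rw [pairSrc_add, add_comm l n, ha.periodic, walk]
  have hF : FreeStep a (pairSrc a l i j) π l := by
    intro q hq
    have h0 : pairSrc a l i j π l = j := pairSrc_add (a := a) (π := π) i j 0
    rw [h0, pairSrc_of_lt i j hq]
    exact ⟨fun h => hj q hq.le h.2, fun h => hj (q + 1) hq h.2⟩
  have hfree := freeStep_of_no_coincidence (X := {i, j}) (e := 2 * l) ha.reduced
    (src := pairSrc a l i j) (s := l) (π := π) ?_ ?_ ?_ hF (2 * l - 1) (by omega) (by omega)
  · refine hcon ⟨2 * l - 1, by omega, by omega, hfree, Or.inl ?_⟩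
    have h1 : 2 * l - 1 = l + (l - 1) := by omega
    rw [h1, htgt, Nat.sub_add_cancel hpos, hc]
    simp
  · intro q _
    rcases Nat.lt_or_ge q l with h | h
    · rw [pairSrc_of_lt i j h]
      cases q with
      | zero => left; simp [walk]
      | succ q =>
        right
        exact ⟨q, by omega, by rw [pairSrc_of_lt i j (by omega), walk]⟩
    · obtain ⟨m, rfl⟩ := Nat.exists_eq_add_of_le h
      cases m with
      | zero => left; simp [pairSrc, walk]
      | succ m => exact Or.inr ⟨l + m, by omega, by rw [htgt, pairSrc_add]⟩
  · intro n hn _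
    obtain ⟨m, rfl⟩ := Nat.exists_eq_add_of_le hn
    rw [htgt, add_assoc, pairSrc_add]
  · exact fun n h1 h2 h3 => hcon ⟨n, h1, h2, h3⟩

omit [DecidableEq κ] [DecidableEq V] in
/-- A closed simple walk only makes free steps. -/
theorem freeStep_last_of_simple (ha : IsPrimitiveWord a l) {i : V}
    (hs : ∀ m < l, ∀ n < l, walk π a i m = walk π a i n → m = n) :
    FreeStep a (fun π => walk π a i) π (l - 1) := by
  have hpos := ha.pos
  intro q hq
  refine ⟨fun h => ?_, fun h => ?_⟩
  · exact absurd (hs q (by omega) (l - 1) (by omega) h.2) hq.ne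
  · have := hs (q + 1) (by omega) (l - 1) (by omega) h.2
    apply ha.reduced q
    rw [h.1, this, flipLetter_flipLetter]

/-- The unoriented edge traversed at time `n`: its generator, and its source for that generator. -/
def edgeKey (π : κ → Equiv.Perm V) (a : ℕ → κ × Bool) (x : V) (n : ℕ) : κ × V :=
  ((a n).1, if (a n).2 then walk π a x (n + 1) else walk π a x n)

omit [DecidableEq κ] [DecidableEq V] in
theorem edgeKey_eq {x y : V} {n m : ℕ} (h : edgeKey π a x n = edgeKey π a y m) :
    (a n = a m ∧ walk π a x n = walk π a y m) ∨
      (a n = flipLetter (a m) ∧ walk π a x n = walk π a y (m + 1)) := by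
  simp only [edgeKey, walk] at h ⊢
  generalize a n = b at h ⊢
  generalize a m = c at h ⊢
  rcases b with ⟨s, β⟩
  rcases c with ⟨s', β'⟩
  simp only [Prod.mk.injEq] at h
  obtain ⟨rfl, h⟩ := h
  cases β <;> cases β' <;> simp_all [act, flipLetter]
  rw [← h]
  simp

omit [DecidableEq κ] [DecidableEq V] in
theorem edgeKey_injOn_of_simple (ha : IsPrimitiveWord a l) {i : V} (hc : walk π a i l = i)
    (hs : ∀ m < l, ∀ n < l, walk π a i m = walk π a i n → m = n) {m n : ℕ} (hm : m < l)
    (hn : n < l) (h : edgeKey π a i m = edgeKey π a i n) : m = n := by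
  rcases edgeKey_eq h with ⟨-, e⟩ | ⟨e, e'⟩
  · exact hs m hm n hn e
  · exfalso
    rw [← walk_mod ha hc (n + 1)] at e'
    have := hs m hm _ (Nat.mod_lt _ ha.pos) e'
    apply ha.reduced n
    rw [← ha.mod_eq (n + 1), ← this, e]

/-- If the walk from `i` is a simple cycle, then a walk from another vertex misses one of its
edges. -/
theorem exists_edgeKey_ne (ha : IsPrimitiveWord a l) {i j : V} (hij : i ≠ j)
    (hc : walk π a i l = i)
    (hs : ∀ m < l, ∀ n < l, walk π a i m = walk π a i n → m = n) :
    ∃ q < l, ∀ n < l, edgeKey π a j n ≠ edgeKey π a i q := by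
  by_contra! hcon
  have hmod : ∀ m n, walk π a i m = walk π a i n → m ≡ n [MOD l] := by
    intro m n h
    rw [← walk_mod ha hc m, ← walk_mod ha hc n] at h
    exact hs _ (Nat.mod_lt _ ha.pos) _ (Nat.mod_lt _ ha.pos) h
  have hamod : ∀ {m n}, m ≡ n [MOD l] → a m = a n := by
    intro m n h
    rw [← ha.mod_eq m, ← ha.mod_eq n]
    exact congrArg a h
  have himg : (Finset.range l).image (edgeKey π a i) = (Finset.range l).image (edgeKey π a j) := by
    refine Finset.eq_of_subset_of_card_le ?_ ?_
    · intro e he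
      simp only [Finset.mem_image, Finset.mem_range] at he ⊢
      obtain ⟨q, hq, rfl⟩ := he
      obtain ⟨n, hn, h⟩ := hcon q hq
      exact ⟨n, hn, h⟩
    · refine Finset.card_image_le.trans ?_
      rw [Finset.card_image_of_injOn]
      intro m hm n hn h
      exact edgeKey_injOn_of_simple ha hc hs (by simpa using hm) (by simpa using hn) h
  have huse : ∀ n < l, ∃ q < l, edgeKey π a j n = edgeKey π a i q := by
    intro n hn
    have : edgeKey π a j n ∈ (Finset.range l).image (edgeKey π a i) := by
      rw [himg]
      exact Finset.mem_image_of_mem _ (Finset.mem_range.2 hn)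
    simp only [Finset.mem_image, Finset.mem_range] at this
    obtain ⟨q, hq, h⟩ := this
    exact ⟨q, hq, h.symm⟩
  obtain ⟨q, hq, hq0⟩ := huse 0 ha.pos
  rcases edgeKey_eq hq0 with ⟨e1, e2⟩ | ⟨e1, e2⟩
  · have hq' : 0 < q := by
      rcases Nat.eq_zero_or_pos q with rfl | h
      · exact absurd e2.symm hij
      · exact h
    have hind : ∀ n < l, a n = a (n + q) ∧ walk π a j n = walk π a i (n + q) := by
      intro n
      induction n with
      | zero => intro _; simpa using ⟨e1, e2⟩
      | succ n ih =>
        intro hn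
        obtain ⟨i1, i2⟩ := ih (by omega)
        have h1 : walk π a j (n + 1) = walk π a i (n + 1 + q) := by
          rw [Nat.add_right_comm, walk, walk, i1, i2]
        refine ⟨?_, h1⟩
        obtain ⟨q', -, h⟩ := huse (n + 1) hn
        rcases edgeKey_eq h with ⟨f1, f2⟩ | ⟨f1, f2⟩
        · rw [f1]
          exact hamod (hmod _ _ (f2.symm.trans h1))
        · exfalso
          have h2 := hmod _ _ (f2.symm.trans h1)
          rw [Nat.add_right_comm n 1 q] at h2
          apply ha.reduced n
          rw [f1, hamod (Nat.ModEq.add_right_cancel' 1 h2), i1]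
    refine ha.not_shift hq' hq fun n => ?_
    have h1 := (hind (n % l) (Nat.mod_lt _ ha.pos)).1
    rw [ha.mod_eq] at h1
    rw [h1]
    exact hamod (Nat.ModEq.add_right q (Nat.mod_modEq n l).symm)
  · have hind : ∀ n ≤ q, a n = flipLetter (a (q - n)) ∧
        walk π a j n = walk π a i (q - n + 1) := by
      intro n
      induction n with
      | zero => intro _; exact ⟨e1, e2⟩
      | succ n ih =>
        intro hn
        obtain ⟨i1, i2⟩ := ih (by omega)
        have h1 : walk π a j (n + 1) = walk π a i (q - (n + 1) + 1) := by
          have : q - (n + 1) + 1 = q - n := by omega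
          rw [this, walk, i1, i2, walk, act_flip_act]
        refine ⟨?_, h1⟩
        obtain ⟨q', -, h⟩ := huse (n + 1) (by omega)
        rcases edgeKey_eq h with ⟨f1, f2⟩ | ⟨f1, f2⟩
        · exfalso
          have h2 := hmod _ _ (f2.symm.trans h1)
          have : q - (n + 1) + 1 = q - n := by omega
          rw [this] at h2
          apply ha.reduced n
          rw [f1, hamod h2, i1, flipLetter_flipLetter]
        · rw [f1, hamod (Nat.ModEq.add_right_cancel' 1 (hmod _ _ (f2.symm.trans h1)))]
    rcases Nat.even_or_odd' q with ⟨r, rfl | rfl⟩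
    · have := (hind r (by omega)).1
      rw [(by omega : 2 * r - r = r)] at this
      exact ne_flipLetter _ this
    · have := (hind (r + 1) (by omega)).1
      rw [(by omega : 2 * r + 1 - (r + 1) = r)] at this
      exact ha.reduced r this

end PairWalks

section TraceMoment

variable {κ V : Type*} [DecidableEq κ] [DecidableEq V]
variable {a : ℕ → κ × Bool} {l : ℕ}

/-- The sign `±1` encoded by a bit. -/
def bitSign (b : Bool) : ℝ := if b then 1 else -1

theorem bitSign_not (b : Bool) : bitSign (!b) = -bitSign b := by
  cases b <;> simp [bitSign]

theorem abs_bitSign (b : Bool) : |bitSign b| = 1 := by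
  cases b <;> simp [bitSign]

/-- The product of the signs met by the first `l` steps of a walk. -/
def walkSign (π : κ → Equiv.Perm V) (b : κ → V → Bool) (a : ℕ → κ × Bool) (l : ℕ) (x : V) : ℝ :=
  ∏ n ∈ Finset.range l, bitSign (b (edgeKey π a x n).1 (edgeKey π a x n).2)

/-- The signed number of closed walks of length `l`. -/
def walkTrace [Fintype V] (π : κ → Equiv.Perm V) (b : κ → V → Bool) (a : ℕ → κ × Bool)
    (l : ℕ) : ℝ :=
  ∑ x, if walk π a x l = x then walkSign π b a l x else 0

/-- Negate the bit at `k`. -/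
def flipBit (k : κ × V) (b : κ → V → Bool) : κ → V → Bool :=
  fun s v => if (s, v) = k then !b s v else b s v

theorem flipBit_involutive (k : κ × V) : Function.Involutive (flipBit k) := by
  intro b
  ext s v
  by_cases h : (s, v) = k <;> simp [flipBit, h]

omit [DecidableEq κ] [DecidableEq V] in
theorem abs_walkSign (π : κ → Equiv.Perm V) (b : κ → V → Bool) (x : V) :
    |walkSign π b a l x| = 1 := by
  rw [walkSign, Finset.abs_prod]
  exact Finset.prod_eq_one fun n _ => abs_bitSign _

theorem walkSign_flipBit_of_ne {π : κ → Equiv.Perm V} {b : κ → V → Bool} {x : V} {k : κ × V}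
    (h : ∀ n < l, edgeKey π a x n ≠ k) :
    walkSign π (flipBit k b) a l x = walkSign π b a l x :=
  Finset.prod_congr rfl fun n hn => by
    simp [flipBit, h n (Finset.mem_range.1 hn)]

theorem walkSign_flipBit_of_unique {π : κ → Equiv.Perm V} {b : κ → V → Bool} {x : V} {q : ℕ}
    (hq : q < l) (h : ∀ n < l, edgeKey π a x n = edgeKey π a x q → n = q) :
    walkSign π (flipBit (edgeKey π a x q) b) a l x = -walkSign π b a l x := by
  rw [walkSign, walkSign, ← Finset.mul_prod_erase _ _ (Finset.mem_range.2 hq),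
    ← Finset.mul_prod_erase (Finset.range l) _ (Finset.mem_range.2 hq), ← neg_mul]
  congr 1
  · simp [flipBit, bitSign_not]
  · refine Finset.prod_congr rfl fun n hn => ?_
    rw [Finset.mem_erase, Finset.mem_range] at hn
    have : edgeKey π a x n ≠ edgeKey π a x q := fun e => hn.1 (h n hn.2 e)
    simp [flipBit, this]

/-- The first `l` vertices of the walk from `x` are distinct. -/
def IsSimpleWalk (π : κ → Equiv.Perm V) (a : ℕ → κ × Bool) (l : ℕ) (x : V) : Prop :=
  ∀ m < l, ∀ n < l, walk π a x m = walk π a x n → m = n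

theorem sum_walkSign_mul_eq_zero [Fintype κ] [Fintype V] (ha : IsPrimitiveWord a l)
    {π : κ → Equiv.Perm V} {i j : V} (hij : i ≠ j) (hc : walk π a i l = i)
    (hs : IsSimpleWalk π a l i) :
    ∑ b : κ → V → Bool, walkSign π b a l i * walkSign π b a l j = 0 := by
  obtain ⟨q, hq, hne⟩ := exists_edgeKey_ne ha hij hc hs
  have h := (flipBit_involutive (edgeKey π a i q)).toPerm.sum_comp Finset.univ
    (fun b => walkSign π b a l i * walkSign π b a l j) (by simp)
  have h' : ∀ b : κ → V → Bool, walkSign π (flipBit (edgeKey π a i q) b) a l i *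
      walkSign π (flipBit (edgeKey π a i q) b) a l j =
      -(walkSign π b a l i * walkSign π b a l j) := fun b => by
    rw [walkSign_flipBit_of_unique hq fun n hn e => edgeKey_injOn_of_simple ha hc hs hn hq e,
      walkSign_flipBit_of_ne hne, neg_mul]
  simp only [Function.Involutive.coe_toPerm, h', Finset.sum_neg_distrib] at h
  linarith

omit [DecidableEq κ] [DecidableEq V] in
theorem sum_walkSign_mul_le [Fintype κ] [Fintype V] [DecidableEq κ] [DecidableEq V]
    (π : κ → Equiv.Perm V) (i j : V) :
    ∑ b : κ → V → Bool, walkSign π b a l i * walkSign π b a l j ≤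
      Fintype.card (κ → V → Bool) := by
  refine (Finset.sum_le_card_nsmul _ _ 1 fun b _ => ?_).trans (by simp)
  refine (le_abs_self _).trans ?_
  rw [abs_mul, abs_walkSign, abs_walkSign, one_mul]

open Classical in
theorem sum_sq_walkTrace_fixed_le [Fintype κ] [Fintype V] (ha : IsPrimitiveWord a l)
    (π : κ → Equiv.Perm V) :
    ∑ b : κ → V → Bool, walkTrace π b a l ^ 2 ≤
      ((∑ i, if walk π a i l = i ∧ IsSimpleWalk π a l i then (1 : ℝ) else 0) +
        (∑ i, if walk π a i l = i ∧ ¬ IsSimpleWalk π a l i then (l + 1 : ℝ) else 0) +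
        ∑ i, ∑ j, if (walk π a i l = i ∧ ¬ IsSimpleWalk π a l i) ∧ walk π a j l = j ∧
          ∀ q ≤ l, walk π a i q ≠ j then (1 : ℝ) else 0) * Fintype.card (κ → V → Bool) := by
  have hexp : ∑ b : κ → V → Bool, walkTrace π b a l ^ 2 =
      ∑ i, ∑ j, if walk π a i l = i ∧ walk π a j l = j then
        ∑ b : κ → V → Bool, walkSign π b a l i * walkSign π b a l j else 0 := by
    simp only [walkTrace, sq, Finset.sum_mul_sum]
    rw [Finset.sum_comm]
    refine Finset.sum_congr rfl fun i _ => ?_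
    rw [Finset.sum_comm]
    refine Finset.sum_congr rfl fun j _ => ?_
    by_cases h1 : walk π a i l = i <;> by_cases h2 : walk π a j l = j <;> simp [h1, h2]
  rw [hexp, ← Finset.sum_add_distrib, ← Finset.sum_add_distrib, Finset.sum_mul]
  refine Finset.sum_le_sum fun i _ => ?_
  have hcard : (0 : ℝ) ≤ Fintype.card (κ → V → Bool) := Nat.cast_nonneg _
  by_cases hi : walk π a i l = i
  swap
  · simp [hi]
  by_cases hs : IsSimpleWalk π a l i
  · rw [Finset.sum_eq_single i]
    · simpa [hi, hs] using sum_walkSign_mul_le π i i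
    · intro j _ hj
      rw [sum_walkSign_mul_eq_zero ha hj.symm hi hs, ite_self]
    · simp
  · simp only [hi, hs, true_and, not_false_eq_true, and_false, if_true, if_false, zero_add]
    have hvis : (∑ j, if ∃ q ≤ l, walk π a i q = j then (1 : ℝ) else 0) ≤ l + 1 := by
      rw [Finset.sum_boole]
      have : (Finset.univ.filter fun j => ∃ q ≤ l, walk π a i q = j) ⊆
          (Finset.range (l + 1)).image (walk π a i) := by
        intro j hj
        obtain ⟨q, hq, e⟩ := (Finset.mem_filter.1 hj).2
        exact Finset.mem_image.2 ⟨q, Finset.mem_range.2 (by omega), e⟩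
      have := (Finset.card_le_card this).trans Finset.card_image_le
      rw [Finset.card_range] at this
      exact_mod_cast this
    calc _ ≤ ∑ j, ((if ∃ q ≤ l, walk π a i q = j then (1 : ℝ) else 0) +
          (if walk π a j l = j ∧ ∀ q ≤ l, walk π a i q ≠ j then (1 : ℝ) else 0)) *
            Fintype.card (κ → V → Bool) := by
          refine Finset.sum_le_sum fun j _ => ?_
          by_cases hj : walk π a j l = j
          · simp only [hj, if_true, true_and]
            refine (sum_walkSign_mul_le π i j).trans ?_
            by_cases hv : ∃ q ≤ l, walk π a i q = j
            · have hv' : ¬ ∀ q ≤ l, walk π a i q ≠ j := by push Not; exact hv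
              simp [hv, hv']
            · have hv' : ∀ q ≤ l, walk π a i q ≠ j := by push Not at hv; exact hv
              simp only [if_neg hv, if_pos hv', zero_add, one_mul]; exact le_rfl
          · simp only [hj, if_false, false_and]
            refine mul_nonneg ?_ hcard
            split_ifs <;> simp
      _ ≤ _ := by
          rw [← Finset.sum_mul, Finset.sum_add_distrib]
          gcongr

theorem card_closed_simple_le [Fintype κ] [Fintype V] (ha : IsPrimitiveWord a l)
    (i : V) : (Fintype.card V - 2 * l) *
      (Nat.card {π : κ → Equiv.Perm V // walk π a i l = i ∧ IsSimpleWalk π a l i}) ≤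
        Fintype.card (κ → Equiv.Perm V) := by
  classical
  have h := card_freeStep_tgt_eq_le (isLocal_walk (a := a) i) (n := l - 1) Finset.univ
    (fun _ _ _ _ => Finset.mem_univ _) (fun _ => i) (fun _ _ _ => rfl)
  rw [Finset.card_univ] at h
  refine le_trans (Nat.mul_le_mul (by omega) ?_) h
  rw [Nat.card_eq_fintype_card, Fintype.card_subtype]
  refine Finset.card_le_card fun π hπ => ?_
  simp only [Finset.mem_filter, Finset.mem_univ, true_and] at hπ ⊢
  refine ⟨freeStep_last_of_simple ha hπ.2, ?_⟩
  have := hπ.1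
  rwa [← Nat.sub_add_cancel ha.pos, walk] at this

theorem card_closed_not_simple_le [Fintype κ] [Fintype V] (ha : IsPrimitiveWord a l)
    (hl : 4 * l < Fintype.card V) (i : V) :
    (Nat.card {π : κ → Equiv.Perm V // walk π a i l = i ∧ ¬ IsSimpleWalk π a l i} : ℝ) ≤
      l ^ 2 * (((2 * l : ℕ) + 2) / (Fintype.card V - 2 * (2 * l : ℕ)) : ℝ) ^ 2 *
        Fintype.card (κ → Equiv.Perm V) := by
  classical
  have hpos := ha.pos
  rw [Nat.card_eq_fintype_card, Fintype.card_subtype]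
  have hsub : (Finset.univ.filter fun π : κ → Equiv.Perm V =>
      walk π a i l = i ∧ ¬ IsSimpleWalk π a l i) ⊆
      ((Finset.range l ×ˢ Finset.range l).filter fun p => p.1 < p.2).biUnion fun p =>
        Finset.univ.filter fun π => Coincidence a (fun π => walk π a i) {i} π p.1 ∧
          Coincidence a (fun π => walk π a i) {i} π p.2 := by
    intro π hπ
    simp only [Finset.mem_filter, Finset.mem_univ, true_and] at hπ
    obtain ⟨n₁, n₂, h12, h2, c1, c2⟩ := exists_two_coincidences ha hπ.1 hπ.2
    simp only [Finset.mem_biUnion, Finset.mem_filter, Finset.mem_product, Finset.mem_range,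
      Finset.mem_univ, true_and]
    exact ⟨(n₁, n₂), ⟨⟨by omega, h2⟩, h12⟩, c1, c2⟩
  have h1 := (Finset.card_le_card hsub).trans Finset.card_biUnion_le
  have h2 : ((∑ p ∈ (Finset.range l ×ˢ Finset.range l).filter fun p => p.1 < p.2,
      (Finset.univ.filter fun π : κ → Equiv.Perm V =>
        Coincidence a (fun π => walk π a i) {i} π p.1 ∧
          Coincidence a (fun π => walk π a i) {i} π p.2).card : ℕ) : ℝ) ≤
      ∑ p ∈ (Finset.range l ×ˢ Finset.range l).filter fun p => p.1 < p.2,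
        (((2 * l : ℕ) + 2) / (Fintype.card V - 2 * (2 * l : ℕ)) : ℝ) ^ 2 *
        Fintype.card (κ → Equiv.Perm V) := by
    push_cast only [Nat.cast_sum]
    refine Finset.sum_le_sum fun p hp => ?_
    simp only [Finset.mem_filter, Finset.mem_product, Finset.mem_range] at hp
    convert card_two_coincidences_le (isLocal_walk (a := a) i) (M := 2 * l) hp.2 (by omega)
      (by omega) {i} (by simp) using 1
  refine (Nat.cast_le.2 h1).trans (h2.trans ?_)
  rw [Finset.sum_const, nsmul_eq_mul, mul_assoc]
  refine mul_le_mul_of_nonneg_right ?_ (by positivity)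
  have := Finset.card_filter_le (Finset.range l ×ˢ Finset.range l) fun p => p.1 < p.2
  rw [Finset.card_product, Finset.card_range, ← sq] at this
  exact_mod_cast this

theorem card_two_closed_le [Fintype κ] [Fintype V] (ha : IsPrimitiveWord a l)
    (hl : 4 * l < Fintype.card V) (i j : V) :
    (Nat.card {π : κ → Equiv.Perm V // (walk π a i l = i ∧ ¬ IsSimpleWalk π a l i) ∧
        walk π a j l = j ∧ ∀ q ≤ l, walk π a i q ≠ j} : ℝ) ≤
      l ^ 3 * (((2 * l : ℕ) + 2) / (Fintype.card V - 2 * (2 * l : ℕ)) : ℝ) ^ 3 *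
        Fintype.card (κ → Equiv.Perm V) := by
  classical
  have hpos := ha.pos
  rw [Nat.card_eq_fintype_card, Fintype.card_subtype]
  set T := ((Finset.range l ×ˢ Finset.range l).filter fun p => p.1 < p.2) ×ˢ Finset.Ico l (2 * l)
    with hT
  have hsub : (Finset.univ.filter fun π : κ → Equiv.Perm V =>
      (walk π a i l = i ∧ ¬ IsSimpleWalk π a l i) ∧
        walk π a j l = j ∧ ∀ q ≤ l, walk π a i q ≠ j) ⊆
      T.biUnion fun p =>
        Finset.univ.filter fun π => (Coincidence a (pairSrc a l i j) {i, j} π p.1.1 ∧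
          Coincidence a (pairSrc a l i j) {i, j} π p.1.2) ∧
          Coincidence a (pairSrc a l i j) {i, j} π p.2 := by
    intro π hπ
    simp only [Finset.mem_filter, Finset.mem_univ, true_and] at hπ
    obtain ⟨⟨hc, hs⟩, hcj, hj⟩ := hπ
    obtain ⟨n₁, n₂, h12, h2, c1, c2⟩ := exists_two_coincidences ha hc hs
    obtain ⟨n₃, h3, h3', c3⟩ := exists_coincidence_second ha hcj hj
    simp only [hT, Finset.mem_biUnion, Finset.mem_filter, Finset.mem_product, Finset.mem_range,
      Finset.mem_univ, true_and, Finset.mem_Ico]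
    exact ⟨((n₁, n₂), n₃), ⟨⟨⟨h12.trans h2, h2⟩, h12⟩, h3, h3'⟩,
      ⟨coincidence_pairSrc_of_walk (h12.trans h2) c1, coincidence_pairSrc_of_walk h2 c2⟩, c3⟩
  have h1 := (Finset.card_le_card hsub).trans Finset.card_biUnion_le
  have h2 : ((∑ p ∈ T,
      (Finset.univ.filter fun π : κ → Equiv.Perm V =>
        (Coincidence a (pairSrc a l i j) {i, j} π p.1.1 ∧
          Coincidence a (pairSrc a l i j) {i, j} π p.1.2) ∧
          Coincidence a (pairSrc a l i j) {i, j} π p.2).card : ℕ) : ℝ) ≤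
      ∑ p ∈ T,
        (((2 * l : ℕ) + 2) / (Fintype.card V - 2 * (2 * l : ℕ)) : ℝ) ^ 3 *
        Fintype.card (κ → Equiv.Perm V) := by
    push_cast only [Nat.cast_sum]
    refine Finset.sum_le_sum fun p hp => ?_
    simp only [hT, Finset.mem_filter, Finset.mem_product, Finset.mem_range, Finset.mem_Ico] at hp
    convert card_three_coincidences_le (isLocal_pairSrc ha.periodic i j) (M := 2 * l) hp.1.2
      (hp.1.1.2.trans_le hp.2.1) hp.2.2 (by omega) {i, j} (Finset.card_le_two) using 1
  refine (Nat.cast_le.2 h1).trans (h2.trans ?_)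
  rw [Finset.sum_const, nsmul_eq_mul, mul_assoc]
  have hden : (0 : ℝ) ≤ Fintype.card V - 2 * (2 * l : ℕ) := by
    have : ((4 * l : ℕ) : ℝ) < Fintype.card V := by exact_mod_cast hl
    push_cast at this ⊢
    linarith
  refine mul_le_mul_of_nonneg_right ?_ (by positivity)
  have := Finset.card_filter_le (Finset.range l ×ˢ Finset.range l) fun p => p.1 < p.2
  rw [Finset.card_product, Finset.card_range, ← sq] at this
  have h3 : T.card ≤ l ^ 3 := by
    rw [hT, Finset.card_product, Nat.card_Ico, pow_succ]
    exact Nat.mul_le_mul this (by omega)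
  exact_mod_cast h3

/-- The second moment of the signed number of closed walks along a primitive word. -/
theorem sum_sq_walkTrace_le [Fintype κ] [Fintype V] (ha : IsPrimitiveWord a l)
    (hl : 8 * l ≤ Fintype.card V) :
    ∑ π : κ → Equiv.Perm V, ∑ b : κ → V → Bool, walkTrace π b a l ^ 2 ≤
      (1 + 644 * l ^ 6 / Fintype.card V) *
        (Fintype.card (κ → Equiv.Perm V) * Fintype.card (κ → V → Bool)) := by
  classical
  have hpos := ha.pos
  set N : ℝ := (Fintype.card V : ℝ) with hN
  have hlN : 8 * (l : ℝ) ≤ N := by rw [hN]; exact_mod_cast hl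
  have hl1 : (1 : ℝ) ≤ l := by exact_mod_cast hpos
  have hNpos : 0 < N := by linarith
  set Q : ℝ := (Fintype.card (κ → Equiv.Perm V) : ℝ) with hQ
  have hQ0 : 0 ≤ Q := Nat.cast_nonneg _
  set r : ℝ := (((2 * l : ℕ) + 2) / (N - 2 * (2 * l : ℕ)) : ℝ) with hr
  have hr0 : 0 ≤ r := by
    rw [hr]; push_cast
    exact div_nonneg (by positivity) (by linarith)
  have hr1 : r ≤ 8 * l / N := by
    rw [hr]; push_cast
    rw [div_le_div_iff₀ (by linarith) hNpos]
    nlinarith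
  have hA : ∀ i : V, (Nat.card {π : κ → Equiv.Perm V //
      walk π a i l = i ∧ IsSimpleWalk π a l i} : ℝ) ≤ (1 + 4 * l / N) / N * Q := by
    intro i
    have h := card_closed_simple_le (κ := κ) ha i
    have h' : ((Fintype.card V - 2 * l : ℕ) : ℝ) * (Nat.card {π : κ → Equiv.Perm V //
      walk π a i l = i ∧ IsSimpleWalk π a l i} : ℝ) ≤ Q := by rw [hQ]; exact_mod_cast h
    rw [Nat.cast_sub (by omega), ← hN] at h'
    push_cast at h'
    set A : ℝ := (Nat.card {π : κ → Equiv.Perm V // walk π a i l = i ∧ IsSimpleWalk π a l i} : ℝ)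
    have hA0 : 0 ≤ A := Nat.cast_nonneg _
    have : 1 ≤ (1 + 4 * l / N) / N * (N - 2 * l) := by
      rw [div_mul_eq_mul_div, le_div_iff₀ hNpos]
      have : (1 + 4 * l / N) * (N - 2 * l) = N + 2 * l - 8 * l ^ 2 / N := by
        field_simp; ring
      rw [this]
      have : 8 * (l : ℝ) ^ 2 / N ≤ l := by
        rw [div_le_iff₀ hNpos]; nlinarith
      linarith
    calc A ≤ ((1 + 4 * l / N) / N * (N - 2 * l)) * A := le_mul_of_one_le_left hA0 this
      _ = (1 + 4 * l / N) / N * ((N - 2 * l) * A) := by ring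
      _ ≤ _ := by gcongr
  have hB : ∀ i : V, (Nat.card {π : κ → Equiv.Perm V //
      walk π a i l = i ∧ ¬ IsSimpleWalk π a l i} : ℝ) ≤ l ^ 2 * (8 * l / N) ^ 2 * Q := fun i =>
    (card_closed_not_simple_le ha (by omega) i).trans (by rw [← hN, ← hr, ← hQ]; gcongr)
  have hC : ∀ i j : V, (Nat.card {π : κ → Equiv.Perm V //
      (walk π a i l = i ∧ ¬ IsSimpleWalk π a l i) ∧ walk π a j l = j ∧
        ∀ q ≤ l, walk π a i q ≠ j} : ℝ) ≤ l ^ 3 * (8 * l / N) ^ 3 * Q := fun i j =>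
    (card_two_closed_le ha (by omega) i j).trans (by rw [← hN, ← hr, ← hQ]; gcongr)
  have hind : ∀ (P : (κ → Equiv.Perm V) → Prop) [DecidablePred P] (c : ℝ),
      ∑ π, (if P π then c else 0) = Nat.card {π // P π} * c := by
    intro P _ c
    rw [Nat.card_eq_fintype_card, Fintype.card_subtype, ← Finset.sum_filter, Finset.sum_const,
      nsmul_eq_mul]
  calc _ ≤ ∑ π : κ → Equiv.Perm V, _ :=
        Finset.sum_le_sum fun π _ => sum_sq_walkTrace_fixed_le ha π
    _ = ((∑ i, (Nat.card {π : κ → Equiv.Perm V //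
          walk π a i l = i ∧ IsSimpleWalk π a l i} : ℝ) * 1) +
        (∑ i, (Nat.card {π : κ → Equiv.Perm V //
          walk π a i l = i ∧ ¬ IsSimpleWalk π a l i} : ℝ) * (l + 1)) +
        ∑ i, ∑ j, (Nat.card {π : κ → Equiv.Perm V //
          (walk π a i l = i ∧ ¬ IsSimpleWalk π a l i) ∧ walk π a j l = j ∧
            ∀ q ≤ l, walk π a i q ≠ j} : ℝ) * 1) * Fintype.card (κ → V → Bool) := by
        rw [← Finset.sum_mul, Finset.sum_add_distrib, Finset.sum_add_distrib]
        congr 3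
        · rw [Finset.sum_comm]
          exact Finset.sum_congr rfl fun i _ => by rw [← hind]
        · rw [Finset.sum_comm]
          exact Finset.sum_congr rfl fun i _ => by rw [← hind]
        · rw [Finset.sum_comm]
          refine Finset.sum_congr rfl fun i _ => ?_
          rw [Finset.sum_comm]
          exact Finset.sum_congr rfl fun j _ => by rw [← hind]
    _ ≤ ((∑ _i : V, (1 + 4 * l / N) / N * Q) +
        (∑ _i : V, l ^ 2 * (8 * l / N) ^ 2 * Q * (l + l)) +
        ∑ _i : V, ∑ _j : V, l ^ 3 * (8 * l / N) ^ 3 * Q) * Fintype.card (κ → V → Bool) := by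
        refine mul_le_mul_of_nonneg_right (add_le_add (add_le_add ?_ ?_) ?_) (Nat.cast_nonneg _)
        · exact Finset.sum_le_sum fun i _ => (mul_one _).trans_le (hA i)
        · exact Finset.sum_le_sum fun i _ => mul_le_mul (hB i) (by linarith) (by positivity)
            (by positivity)
        · exact Finset.sum_le_sum fun i _ => Finset.sum_le_sum fun j _ =>
            (mul_one _).trans_le (hC i j)
    _ = (1 + (4 * l + 128 * l ^ 5 + 512 * l ^ 6) / N) *
        (Q * Fintype.card (κ → V → Bool)) := by
        simp only [Finset.sum_const, Finset.card_univ, nsmul_eq_mul, ← hN]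
        field_simp
        ring
    _ ≤ _ := by
        have h1 : (l : ℝ) ≤ l ^ 6 := le_self_pow₀ hl1 (by norm_num)
        have h2 : (l : ℝ) ^ 5 ≤ l ^ 6 := pow_le_pow_right₀ hl1 (by norm_num)
        gcongr
        linarith

end TraceMoment

section FreeGroupCounting

open FreeGroup

variable {κ : Type*} [DecidableEq κ]

/-- A finite word that is a power of a word at most half as long. -/
def IsRepetitive {α : Type*} (v : List α) : Prop :=
  ∃ T, 2 * T ≤ v.length ∧ T ∣ v.length ∧ ∀ n < v.length, v[n]? = v[n % T]?

theorem sum_fin_succ_ofFn {α M : Type*} [Fintype α] [AddCommMonoid M] (F : List α → M) (m : ℕ) :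
    ∑ w : Fin (m + 1) → α, F (List.ofFn w) =
      ∑ c : α, ∑ w : Fin m → α, F (c :: List.ofFn w) := by
  rw [← Fintype.sum_prod_type', ← (Fin.consEquiv fun _ : Fin (m + 1) => α).sum_comp]
  simp [Fin.consEquiv]

theorem norm_mk_inv_mul_of_ne {c d : κ × Bool} {L : List (κ × Bool)} (hL : FreeGroup.IsReduced (d :: L))
    (h : c ≠ d) : FreeGroup.norm ((mk [c])⁻¹ * mk (d :: L)) = L.length + 2 := by
  have : FreeGroup.IsReduced ((c.1, !c.2) :: d :: L) := by
    rw [FreeGroup.IsReduced, List.isChain_cons_cons]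
    refine ⟨fun h1 => ?_, hL⟩
    rcases c with ⟨s, β⟩
    rcases d with ⟨s', β'⟩
    simp only at h1
    subst h1
    cases β <;> cases β' <;> simp_all
  rw [inv_mk, invRev, List.map_singleton, List.reverse_singleton, mul_mk, FreeGroup.norm, toWord_mk,
    List.singleton_append, this.reduce_eq]
  simp

theorem sum_pow_norm_mk_inv_mul_le [Fintype κ] {q : ℝ} (hq : 0 < q) (hq1 : q ≤ 1)
    (hq2 : (2 * Fintype.card κ - 1) * q ^ 2 = 1) (g : FreeGroup κ) :
    ∑ c : κ × Bool, q ^ FreeGroup.norm ((mk [c])⁻¹ * g) ≤ 2 * q⁻¹ * q ^ FreeGroup.norm g := by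
  have hcard : (Fintype.card (κ × Bool) : ℝ) = q⁻¹ ^ 2 + 1 := by
    rw [Fintype.card_prod, Fintype.card_bool]
    push_cast
    field_simp
    linarith
  rcases hL : g.toWord with - | ⟨d, L⟩
  · rw [toWord_eq_nil_iff] at hL
    subst hL
    have : ∀ c : κ × Bool, FreeGroup.norm ((mk [c])⁻¹ * 1) = 1 := fun c => by
      rw [mul_one, FreeGroup.norm_inv_eq, FreeGroup.norm, toWord_mk, reduce_singleton, List.length_singleton]
    rw [Finset.sum_congr rfl fun c _ => by rw [this c, pow_one], Finset.sum_const,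
      Finset.card_univ, nsmul_eq_mul, FreeGroup.norm_one, pow_zero, mul_one, hcard]
    have : (q⁻¹ ^ 2 + 1) * q = q⁻¹ + q := by field_simp
    rw [this]
    have : 1 ≤ q⁻¹ := (one_le_inv₀ hq).2 hq1
    linarith
  · have hred : FreeGroup.IsReduced (d :: L) := hL ▸ isReduced_toWord
    have hg : g = mk (d :: L) := by rw [← hL, mk_toWord]
    have hn : FreeGroup.norm g = L.length + 1 := by rw [FreeGroup.norm, hL, List.length_cons]
    have hne : ∀ c ∈ Finset.univ.erase d, q ^ FreeGroup.norm ((mk [c])⁻¹ * g) = q ^ (FreeGroup.norm g + 1) := by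
      intro c hc
      rw [hn, hg, norm_mk_inv_mul_of_ne hred (Finset.ne_of_mem_erase hc)]
    have hself : q ^ FreeGroup.norm ((mk [d])⁻¹ * g) = q⁻¹ * q ^ FreeGroup.norm g := by
      have : (mk [d])⁻¹ * g = mk L := by
        rw [hg, inv_mul_eq_iff_eq_mul, mul_mk, List.singleton_append]
      rw [this, hn, FreeGroup.norm, toWord_mk, FreeGroup.IsReduced.reduce_eq (L := L) (List.IsChain.tail hred), pow_succ]
      field_simp
    rw [← Finset.add_sum_erase _ _ (Finset.mem_univ d), Finset.sum_congr rfl hne, hself,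
      Finset.sum_const, Finset.card_erase_of_mem (Finset.mem_univ d), Finset.card_univ,
      nsmul_eq_mul, Nat.cast_sub (Fintype.card_pos_iff.2 ⟨d⟩), hcard]
    apply le_of_eq
    rw [pow_succ]
    push_cast
    field_simp
    ring

/-- The number of words of length `m` representing `g`, bounded by a supersolution of the
recursion for the return probabilities on the regular tree. -/
theorem card_words_le [Fintype κ] {q : ℝ} (hq : 0 < q) (hq1 : q ≤ 1)
    (hq2 : (2 * Fintype.card κ - 1) * q ^ 2 = 1) (m : ℕ) (g : FreeGroup κ) :
    ∑ w : Fin m → κ × Bool, (if mk (List.ofFn w) = g then (1 : ℝ) else 0) ≤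
      (2 * q⁻¹) ^ m * q ^ FreeGroup.norm g := by
  induction m generalizing g with
  | zero =>
    by_cases h : g = 1
    · simp [h, ← one_eq_mk]
    · have h' : (1 : FreeGroup κ) ≠ g := fun e => h e.symm
      simp only [List.ofFn_zero, ← one_eq_mk, h', if_false, Finset.sum_const_zero]
      positivity
  | succ m ih =>
    rw [sum_fin_succ_ofFn (fun L => if mk L = g then (1 : ℝ) else 0)]
    have hc : ∀ (c : κ × Bool) (L : List (κ × Bool)), mk (c :: L) = g ↔ mk L = (mk [c])⁻¹ * g := by
      intro c L
      rw [eq_inv_mul_iff_mul_eq, mul_mk, List.singleton_append]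
    simp only [hc]
    calc _ ≤ ∑ c : κ × Bool, (2 * q⁻¹) ^ m * q ^ FreeGroup.norm ((mk [c])⁻¹ * g) :=
          Finset.sum_le_sum fun c _ => ih _
      _ = (2 * q⁻¹) ^ m * ∑ c : κ × Bool, q ^ FreeGroup.norm ((mk [c])⁻¹ * g) := by rw [Finset.mul_sum]
      _ ≤ (2 * q⁻¹) ^ m * (2 * q⁻¹ * q ^ FreeGroup.norm g) := by
          gcongr
          exact sum_pow_norm_mk_inv_mul_le hq hq1 hq2 g
      _ = _ := by ring

open Classical in
/-- The reduced words of length `n`. -/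
noncomputable def reducedWords (κ : Type*) [Fintype κ] : ℕ → Finset (List (κ × Bool))
  | 0 => {[]}
  | n + 1 => (reducedWords κ n).biUnion fun L =>
      (Finset.univ.filter fun c : κ × Bool => FreeGroup.IsReduced (c :: L)).image fun c => c :: L

omit [DecidableEq κ] in
theorem mem_reducedWords [Fintype κ] {L : List (κ × Bool)} (hL : FreeGroup.IsReduced L) :
    L ∈ reducedWords κ L.length := by
  induction L with
  | nil => simp [reducedWords]
  | cons c L ih =>
    simp only [List.length_cons, reducedWords, Finset.mem_biUnion, Finset.mem_image,
      Finset.mem_filter, Finset.mem_univ, true_and]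
    exact ⟨L, ih (List.IsChain.tail hL), c, hL, rfl⟩

omit [DecidableEq κ] in
theorem length_of_mem_reducedWords [Fintype κ] {n : ℕ} {L : List (κ × Bool)}
    (h : L ∈ reducedWords κ n) : L.length = n := by
  induction n generalizing L with
  | zero => simpa [reducedWords] using h
  | succ n ih =>
    simp only [reducedWords, Finset.mem_biUnion, Finset.mem_image] at h
    obtain ⟨L', h1, c, -, rfl⟩ := h
    rw [List.length_cons, ih h1]

omit [DecidableEq κ] in
theorem card_reducedWords_le [Fintype κ] [Nonempty κ] (n : ℕ) :
    (reducedWords κ n).card ≤ 2 * (2 * Fintype.card κ - 1) ^ n := by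
  classical
  have hk : 0 < Fintype.card κ := Fintype.card_pos
  have hD : Fintype.card (κ × Bool) = 2 * Fintype.card κ := by
    rw [Fintype.card_prod, Fintype.card_bool, mul_comm]
  rcases n with - | n
  · simp [reducedWords]
  induction n with
  | zero =>
    simp only [reducedWords, Finset.singleton_biUnion]
    refine Finset.card_image_le.trans ((Finset.card_filter_le _ _).trans ?_)
    rw [Finset.card_univ, hD, zero_add, pow_one]
    omega
  | succ n ih =>
    rw [reducedWords]
    refine (Finset.card_biUnion_le_card_mul _ _ (2 * Fintype.card κ - 1) fun L hL => ?_).trans ?_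
    · have hlen := length_of_mem_reducedWords hL
      rcases L with - | ⟨d, L⟩
      · simp at hlen
      refine Finset.card_image_le.trans ?_
      have : (Finset.univ.filter fun c : κ × Bool => FreeGroup.IsReduced (c :: d :: L)) ⊆
          Finset.univ.erase (d.1, !d.2) := by
        intro c hc
        simp only [Finset.mem_filter, Finset.mem_univ, true_and, Finset.mem_erase, and_true]
          at hc ⊢
        rintro rfl
        simpa using List.IsChain.rel hc
      refine (Finset.card_le_card this).trans ?_
      rw [Finset.card_erase_of_mem (Finset.mem_univ _), Finset.card_univ, hD]
    · rw [pow_succ, ← mul_assoc]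
      exact Nat.mul_le_mul_right _ ih

/-- The cyclic reduction of a word. -/
def wordCore (L : List (κ × Bool)) : List (κ × Bool) := reduceCyclically (reduce L)

theorem length_conjugator_add (L : List (κ × Bool)) :
    2 * (reduceCyclically.conjugator L).length + (reduceCyclically L).length = L.length := by
  conv_rhs => rw [← reduceCyclically.conj_conjugator_reduceCyclically L]
  simp only [List.length_append, invRev_length]
  omega

theorem isReduced_conjugator {L : List (κ × Bool)} (hL : FreeGroup.IsReduced L) :
    FreeGroup.IsReduced (reduceCyclically.conjugator L) := by
  refine List.IsChain.infix hL ⟨[], reduceCyclically L ++ invRev (reduceCyclically.conjugator L), ?_⟩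
  rw [List.nil_append, ← List.append_assoc]
  exact reduceCyclically.conj_conjugator_reduceCyclically L

/-- The group elements of given length whose cyclic reduction is a given power. -/
theorem card_repetitive_core_le [Fintype κ] [Nonempty κ] (S : Finset (FreeGroup κ)) {a l T : ℕ}
    (hT : 2 * T ≤ l) (hTl : T ∣ l)
    (hS : ∀ g ∈ S, (reduceCyclically.conjugator g.toWord).length = a ∧
      (reduceCyclically g.toWord).length = l ∧
      ∀ n < l, (reduceCyclically g.toWord)[n]? = (reduceCyclically g.toWord)[n % T]?) :
    S.card ≤ 4 * (2 * Fintype.card κ - 1) ^ (a + T) := by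
  have h : S.card ≤ (reducedWords κ a ×ˢ reducedWords κ T).card := by
    refine Finset.card_le_card_of_injOn
      (fun g => (reduceCyclically.conjugator g.toWord, (reduceCyclically g.toWord).take T)) ?_ ?_
    · intro g hg
      obtain ⟨h1, h2, -⟩ := hS g hg
      rw [Finset.coe_product, Set.mem_prod]
      constructor
      · rw [← h1]
        exact mem_reducedWords (isReduced_conjugator (isReduced_toWord (x := g)))
      · have : ((reduceCyclically g.toWord).take T).length = T := by
          rw [List.length_take, h2]
          omega
        have hmem := mem_reducedWords
          (List.IsChain.take (reduceCyclically.isCyclicallyReduced (isReduced_toWord (x := g))).1 T)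
        rwa [this] at hmem
    · intro g hg g' hg' he
      obtain ⟨-, h2, h3⟩ := hS g hg
      obtain ⟨-, h2', h3'⟩ := hS g' hg'
      simp only [Prod.mk.injEq] at he
      obtain ⟨e1, e2⟩ := he
      have hcore : reduceCyclically g.toWord = reduceCyclically g'.toWord := by
        refine List.ext_getElem? fun n => ?_
        by_cases hn : n < l
        · have hT0 : 0 < T := by
            rcases Nat.eq_zero_or_pos T with rfl | h
            · rw [zero_dvd_iff] at hTl
              omega
            · exact h
          have hmod := Nat.mod_lt n hT0
          rw [h3 n hn, h3' n hn, ← List.getElem?_take_of_lt hmod, e2,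
            List.getElem?_take_of_lt hmod]
        · rw [List.getElem?_eq_none (by omega), List.getElem?_eq_none (by omega)]
      apply toWord_injective
      rw [← reduceCyclically.conj_conjugator_reduceCyclically g.toWord,
        ← reduceCyclically.conj_conjugator_reduceCyclically g'.toWord, e1, hcore]
  refine h.trans ?_
  rw [Finset.card_product]
  calc _ ≤ (2 * (2 * Fintype.card κ - 1) ^ a) * (2 * (2 * Fintype.card κ - 1) ^ T) :=
        Nat.mul_le_mul (card_reducedWords_le a) (card_reducedWords_le T)
    _ = _ := by ring

/-- Few words have a repetitive cyclic reduction. -/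
theorem card_repetitive_words_le [Fintype κ] [Nonempty κ] {q : ℝ} (hq : 0 < q) (hq1 : q ≤ 1)
    (hq2 : (2 * Fintype.card κ - 1) * q ^ 2 = 1) (m : ℕ) :
    (Nat.card {w : Fin m → κ × Bool // IsRepetitive (wordCore (List.ofFn w))} : ℝ) ≤
      4 * (m + 1) ^ 3 * (2 * q⁻¹) ^ m := by
  classical
  set S : Finset (FreeGroup κ) := (Finset.univ.image fun w : Fin m → κ × Bool =>
    mk (List.ofFn w)).filter fun g => IsRepetitive (reduceCyclically g.toWord) with hS
  set I := Finset.range (m + 1) ×ˢ Finset.range (m + 1) ×ˢ Finset.range (m + 1) with hI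
  let P : ℕ × ℕ × ℕ → FreeGroup κ → Prop := fun t g =>
    (2 * t.2.2 ≤ t.2.1 ∧ t.2.2 ∣ t.2.1) ∧
    (reduceCyclically.conjugator g.toWord).length = t.1 ∧
      (reduceCyclically g.toWord).length = t.2.1 ∧
      ∀ n < t.2.1, (reduceCyclically g.toWord)[n]? = (reduceCyclically g.toWord)[n % t.2.2]?
  have hnorm : ∀ g : FreeGroup κ, 2 * (reduceCyclically.conjugator g.toWord).length +
      (reduceCyclically g.toWord).length = FreeGroup.norm g := fun g => length_conjugator_add _
  have hpart : ∀ t ∈ I, ∑ g ∈ S.filter (P t), (2 * q⁻¹) ^ m * q ^ FreeGroup.norm g ≤ 4 * (2 * q⁻¹) ^ m := by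
    rintro ⟨a, l, T⟩ -
    by_cases hT : 2 * T ≤ l ∧ T ∣ l
    swap
    · rw [Finset.filter_false_of_mem (fun g _ h => hT h.1), Finset.sum_empty]
      positivity
    have hcard := card_repetitive_core_le (S.filter (P (a, l, T))) hT.1 hT.2
      fun g hg => (Finset.mem_filter.1 hg).2.2
    have hk : 1 ≤ Fintype.card κ := Fintype.card_pos
    have hcard' : ((S.filter (P (a, l, T))).card : ℝ) ≤ 4 * ((2 * Fintype.card κ - 1 : ℝ)) ^ (a + T) := by
      have : ((2 * Fintype.card κ - 1 : ℕ) : ℝ) = 2 * Fintype.card κ - 1 := by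
        rw [Nat.cast_sub (by omega)]
        push_cast
        ring
      rw [← this]
      exact_mod_cast hcard
    calc _ ≤ ∑ g ∈ S.filter (P (a, l, T)), (2 * q⁻¹) ^ m * q ^ (2 * (a + T)) := by
          refine Finset.sum_le_sum fun g hg => ?_
          obtain ⟨-, h1, h2, -⟩ := (Finset.mem_filter.1 hg).2
          refine mul_le_mul_of_nonneg_left (pow_le_pow_of_le_one hq.le hq1 ?_) (by positivity)
          rw [← hnorm g, h1, h2]
          have := hT.1
          dsimp only
          omega
      _ = (S.filter (P (a, l, T))).card * ((2 * q⁻¹) ^ m * q ^ (2 * (a + T))) := by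
          rw [Finset.sum_const, nsmul_eq_mul]
      _ ≤ 4 * ((2 * Fintype.card κ - 1 : ℝ)) ^ (a + T) * ((2 * q⁻¹) ^ m * q ^ (2 * (a + T))) := by
          gcongr
      _ = 4 * ((2 * Fintype.card κ - 1) * q ^ 2) ^ (a + T) * (2 * q⁻¹) ^ m := by
          rw [mul_pow _ (q ^ 2), ← pow_mul]
          ring
      _ = _ := by rw [hq2, one_pow, mul_one]
  calc (Nat.card {w : Fin m → κ × Bool // IsRepetitive (wordCore (List.ofFn w))} : ℝ)
      = ∑ g ∈ S, ∑ w : Fin m → κ × Bool, (if mk (List.ofFn w) = g then (1 : ℝ) else 0) := by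
        rw [Nat.card_eq_fintype_card, Fintype.card_subtype, Finset.sum_comm, Finset.card_filter]
        push_cast
        refine Finset.sum_congr rfl fun w _ => ?_
        rw [Finset.sum_ite_eq]
        refine if_congr ?_ rfl rfl
        rw [hS, Finset.mem_filter, toWord_mk, wordCore]
        exact ⟨fun h => ⟨Finset.mem_image_of_mem _ (Finset.mem_univ w), h⟩, fun h => h.2⟩
    _ ≤ ∑ g ∈ S, (2 * q⁻¹) ^ m * q ^ FreeGroup.norm g :=
        Finset.sum_le_sum fun g _ => card_words_le hq hq1 hq2 m g
    _ ≤ ∑ g ∈ S, ∑ t ∈ I, if P t g then (2 * q⁻¹) ^ m * q ^ FreeGroup.norm g else 0 := by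
        refine Finset.sum_le_sum fun g hg => ?_
        rw [hS, Finset.mem_filter, Finset.mem_image] at hg
        obtain ⟨⟨w, -, hw⟩, T, hT, hTl, hper⟩ := hg
        have hgm : FreeGroup.norm g ≤ m := by
          rw [← hw]
          exact FreeGroup.norm_mk_le.trans (List.length_ofFn).le
        have := hnorm g
        refine (if_pos ?_ : (if P ((reduceCyclically.conjugator g.toWord).length,
          (reduceCyclically g.toWord).length, T) g then (2 * q⁻¹) ^ m * q ^ FreeGroup.norm g else 0) =
            _).symm.trans_le (Finset.single_le_sum (f := fun t => if P t g then
              (2 * q⁻¹) ^ m * q ^ FreeGroup.norm g else 0) (fun t _ => ?_) ?_)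
        · exact ⟨⟨hT, hTl⟩, rfl, rfl, hper⟩
        · split_ifs <;> positivity
        · simp only [hI, Finset.mem_product, Finset.mem_range]
          omega
    _ = ∑ t ∈ I, ∑ g ∈ S.filter (P t), (2 * q⁻¹) ^ m * q ^ FreeGroup.norm g := by
        rw [Finset.sum_comm]
        exact Finset.sum_congr rfl fun t _ => (Finset.sum_filter _ _).symm
    _ ≤ ∑ t ∈ I, 4 * (2 * q⁻¹) ^ m := Finset.sum_le_sum hpart
    _ = _ := by
        rw [Finset.sum_const, hI, Finset.card_product, Finset.card_product, Finset.card_range,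
          nsmul_eq_mul]
        push_cast
        ring

end FreeGroupCounting

section WordTrace

variable {κ V : Type*} [DecidableEq κ] [DecidableEq V]

/-- The signed permutation matrix attached to a letter. -/
def letterMat (π : κ → Equiv.Perm V) (b : κ → V → Bool) (p : κ × Bool) : Matrix V V ℝ :=
  Matrix.of fun i j => if act π p i = j then bitSign (b p.1 (if p.2 then j else i)) else 0

variable [Fintype V]

omit [DecidableEq κ] in
theorem letterMat_mul_flip (π : κ → Equiv.Perm V) (b : κ → V → Bool) (p : κ × Bool) :
    letterMat π b p * letterMat π b (flipLetter p) = 1 := by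
  ext i j
  rw [Matrix.mul_apply, Finset.sum_eq_single (act π p i)]
  · have hsq : ∀ c, bitSign c * bitSign c = 1 := fun c => by cases c <;> simp [bitSign]
    rcases p with ⟨s, β⟩
    by_cases h : i = j
    · subst h
      cases β <;> simp [letterMat, act, flipLetter, hsq]
    · cases β <;> simp [letterMat, act, flipLetter, h]
  · intro k _ hk
    simp [letterMat, hk.symm]
  · simp

omit [DecidableEq κ] in
theorem prod_letterMat_apply (π : κ → Equiv.Perm V) (b : κ → V → Bool) {a : ℕ → κ × Bool}
    (L : List (κ × Bool)) (ha : ∀ n < L.length, L[n]? = some (a n)) (i j : V) :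
    (L.map (letterMat π b)).prod i j =
      if walk π a i L.length = j then walkSign π b a L.length i else 0 := by
  induction L using List.reverseRecOn generalizing j with
  | nil => simp [walk, walkSign, Matrix.one_apply]
  | append_singleton L c ih =>
    have hL : ∀ n < L.length, L[n]? = some (a n) := fun n hn => by
      rw [← ha n (by simp; omega), List.getElem?_append_left hn]
    have hc : a L.length = c := by
      have := ha L.length (by simp)
      simpa using this.symm
    rw [List.map_append, List.prod_append, List.map_singleton, List.prod_singleton,
      Matrix.mul_apply]
    simp only [ih hL, ite_mul, zero_mul, Finset.sum_ite_eq, Finset.mem_univ, if_true]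
    rw [List.length_append, List.length_singleton, walk, hc, letterMat, Matrix.of_apply, walkSign,
      walkSign, Finset.prod_range_succ, mul_ite, mul_zero]
    by_cases h : act π c (walk π a i L.length) = j
    · simp only [h, if_true, edgeKey, walk, hc]
    · simp only [h, if_false]

/-- The trace of the signed permutation matrix of a word. -/
def wordTrace (π : κ → Equiv.Perm V) (b : κ → V → Bool) (L : List (κ × Bool)) : ℝ :=
  (L.map (letterMat π b)).prod.trace

omit [DecidableEq κ] in
theorem wordTrace_eq_walkTrace (π : κ → Equiv.Perm V) (b : κ → V → Bool) {a : ℕ → κ × Bool}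
    {L : List (κ × Bool)} (ha : ∀ n < L.length, L[n]? = some (a n)) :
    wordTrace π b L = walkTrace π b a L.length := by
  simp only [wordTrace, walkTrace, Matrix.trace, Matrix.diag_apply, prod_letterMat_apply π b L ha]

theorem wordTrace_wordCore (π : κ → Equiv.Perm V) (b : κ → V → Bool) (L : List (κ × Bool)) :
    wordTrace π b (wordCore L) = wordTrace π b L := by
  let f : κ → (Matrix V V ℝ)ˣ := fun s =>
    ⟨letterMat π b (s, true), letterMat π b (s, false), letterMat_mul_flip π b (s, true),
      letterMat_mul_flip π b (s, false)⟩
  have hf : ∀ L : List (κ × Bool), (L.map (letterMat π b)).prod =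
      ((FreeGroup.lift f (FreeGroup.mk L) : (Matrix V V ℝ)ˣ) : Matrix V V ℝ) := by
    intro L
    rw [FreeGroup.lift_mk, ← Units.coeHom_apply, map_list_prod, List.map_map]
    congr 2
    funext ⟨s, β⟩
    cases β <;> rfl
  have hmk : FreeGroup.mk L =
      FreeGroup.mk (FreeGroup.reduceCyclically.conjugator (FreeGroup.reduce L)) *
        FreeGroup.mk (wordCore L) *
        (FreeGroup.mk (FreeGroup.reduceCyclically.conjugator (FreeGroup.reduce L)))⁻¹ := by
    rw [FreeGroup.inv_mk, FreeGroup.mul_mk, FreeGroup.mul_mk, wordCore,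
      FreeGroup.reduceCyclically.conj_conjugator_reduceCyclically, FreeGroup.reduce.self]
  rw [wordTrace, wordTrace, hf, hf, hmk, map_mul, map_mul, map_inv, Units.val_mul, Units.val_mul,
    Matrix.trace_units_conj]

omit [DecidableEq κ] in
theorem wordTrace_sq_le (π : κ → Equiv.Perm V) (b : κ → V → Bool) (L : List (κ × Bool)) :
    wordTrace π b L ^ 2 ≤ (Fintype.card V : ℝ) ^ 2 := by
  rcases L with - | ⟨c, L⟩
  · simp [wordTrace]
  rw [wordTrace_eq_walkTrace π b (a := fun n => (c :: L).getD n c)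
    fun n hn => by simp [List.getElem?_eq_getElem hn]]
  rw [sq_le_sq, Nat.abs_cast]
  refine (Finset.abs_sum_le_sum_abs _ _).trans ((Finset.sum_le_card_nsmul _ _ 1 fun x _ => ?_).trans
    (by simp))
  split_ifs
  · exact (abs_walkSign _ _ _).le
  · simp

/-- The periodic extension of a cyclically reduced word that is not a proper power. -/
theorem exists_isPrimitiveWord {v : List (κ × Bool)} (hv : FreeGroup.IsCyclicallyReduced v)
    (hr : ¬ IsRepetitive v) :
    ∃ a, IsPrimitiveWord a v.length ∧ ∀ n < v.length, v[n]? = some (a n) := by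
  have hpos : 0 < v.length := by
    rcases Nat.eq_zero_or_pos v.length with h | h
    · exact absurd ⟨0, by omega, by simp [h], by simp [h]⟩ hr
    · exact h
  have hmod : ∀ n, n % v.length < v.length := fun n => Nat.mod_lt n hpos
  refine ⟨fun n => v[n % v.length]'(hmod n), ⟨hpos, fun n => by simp, fun n => ?_, ?_⟩, ?_⟩
  · have key : ∀ x y : κ × Bool, (x.1 = y.1 → x.2 = y.2) → y ≠ flipLetter x := by
      rintro ⟨s, β⟩ y h rfl
      simpa [flipLetter] using h rfl
    apply key
    by_cases h : n % v.length + 1 < v.length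
    · have h' : (n + 1) % v.length = n % v.length + 1 := by
        rw [Nat.add_mod, Nat.mod_eq_of_lt (a := 1) (by omega), Nat.mod_eq_of_lt h]
      simp only [h']
      exact List.isChain_iff_getElem.1 hv.1 _ h
    · have h1 : n % v.length = v.length - 1 := by have := hmod n; omega
      have h' : (n + 1) % v.length = 0 := by
        rw [Nat.add_mod, h1, Nat.add_mod_mod, Nat.sub_add_cancel hpos, Nat.mod_self]
      simp only [h', h1]
      refine hv.2 _ ?_ _ ?_
      · rw [List.getLast?_eq_getElem?, List.getElem?_eq_getElem (by omega)]
        rfl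
      · rw [List.head?_eq_getElem?, List.getElem?_eq_getElem hpos]
        rfl
  · intro T hT hTl
    by_contra! hcon
    refine hr ⟨T, ?_, hT, fun n hn => ?_⟩
    · obtain ⟨c, hc⟩ := hT
      have : 2 ≤ c := by
        by_contra hlt
        interval_cases c <;> omega
      rw [hc, mul_comm]
      exact Nat.mul_le_mul_left T this
    · have hT0 : n % T < v.length := (Nat.mod_le _ _).trans_lt hn
      have := hcon n hn
      simp only [Nat.mod_eq_of_lt hn, Nat.mod_eq_of_lt hT0] at this
      rw [List.getElem?_eq_getElem hn, List.getElem?_eq_getElem hT0, this]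
  · intro n hn
    simp only [Nat.mod_eq_of_lt hn]
    exact List.getElem?_eq_getElem hn

theorem length_wordCore_le (L : List (κ × Bool)) : (wordCore L).length ≤ L.length := by
  have h1 := length_conjugator_add (FreeGroup.reduce L)
  have h2 := (FreeGroup.reduce.red (L := L)).length_le
  rw [wordCore]
  omega

theorem sum_sq_wordTrace_le_of_not_isRepetitive [Fintype κ] {L : List (κ × Bool)} {m : ℕ}
    (hL : L.length ≤ m) (hm : 8 * m ≤ Fintype.card V) (hr : ¬ IsRepetitive (wordCore L)) :
    ∑ π : κ → Equiv.Perm V, ∑ b : κ → V → Bool, wordTrace π b L ^ 2 ≤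
      (1 + 644 * m ^ 6 / Fintype.card V) *
        (Fintype.card (κ → Equiv.Perm V) * Fintype.card (κ → V → Bool)) := by
  have hcyc : FreeGroup.IsCyclicallyReduced (wordCore L) :=
    FreeGroup.reduceCyclically.isCyclicallyReduced
      (FreeGroup.isReduced_iff_reduce_eq.2 FreeGroup.reduce.idem)
  obtain ⟨a, ha, hget⟩ := exists_isPrimitiveWord hcyc hr
  have hlen : (wordCore L).length ≤ m := (length_wordCore_le L).trans hL
  simp only [← wordTrace_wordCore _ _ L, wordTrace_eq_walkTrace _ _ hget]
  refine (sum_sq_walkTrace_le ha (by omega)).trans ?_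
  gcongr

open Classical in
/-- The averaged second moment of the traces of all words of length `m`. -/
theorem sum_sq_wordTrace_le [Fintype κ] [Nonempty κ] {q : ℝ} (hq : 0 < q) (hq1 : q ≤ 1)
    (hq2 : (2 * Fintype.card κ - 1) * q ^ 2 = 1) {m : ℕ} (hm : 8 * m ≤ Fintype.card V) :
    ∑ π : κ → Equiv.Perm V, ∑ b : κ → V → Bool, ∑ w : Fin m → κ × Bool,
        wordTrace π b (List.ofFn w) ^ 2 ≤
      ((2 * Fintype.card κ) ^ m * (1 + 644 * m ^ 6 / Fintype.card V) +
        4 * (m + 1) ^ 3 * (2 * q⁻¹) ^ m * Fintype.card V ^ 2) *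
        (Fintype.card (κ → Equiv.Perm V) * Fintype.card (κ → V → Bool)) := by
  set QB : ℝ := (Fintype.card (κ → Equiv.Perm V) * Fintype.card (κ → V → Bool) : ℝ) with hQB
  have hQB0 : 0 ≤ QB := by positivity
  have hswap : ∑ π : κ → Equiv.Perm V, ∑ b : κ → V → Bool, ∑ w : Fin m → κ × Bool,
        wordTrace π b (List.ofFn w) ^ 2 = ∑ w : Fin m → κ × Bool,
        ∑ π : κ → Equiv.Perm V, ∑ b : κ → V → Bool, wordTrace π b (List.ofFn w) ^ 2 := by
    rw [Finset.sum_congr rfl fun π _ => Finset.sum_comm]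
    exact Finset.sum_comm
  rw [hswap]
  calc _ ≤ ∑ w : Fin m → κ × Bool, ((1 + 644 * m ^ 6 / Fintype.card V) * QB +
        (if IsRepetitive (wordCore (List.ofFn w)) then (1 : ℝ) else 0) *
          ((Fintype.card V : ℝ) ^ 2 * QB)) := by
        refine Finset.sum_le_sum fun w _ => ?_
        by_cases hr : IsRepetitive (wordCore (List.ofFn w))
        · rw [if_pos hr, one_mul]
          refine le_add_of_nonneg_of_le (by positivity) ?_
          calc _ ≤ ∑ _π : κ → Equiv.Perm V, ∑ _b : κ → V → Bool, (Fintype.card V : ℝ) ^ 2 :=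
                Finset.sum_le_sum fun π _ => Finset.sum_le_sum fun b _ => wordTrace_sq_le π b _
            _ = _ := by
                simp only [Finset.sum_const, Finset.card_univ, nsmul_eq_mul, hQB]
                ring
        · rw [if_neg hr, zero_mul, add_zero]
          exact sum_sq_wordTrace_le_of_not_isRepetitive (List.length_ofFn).le hm hr
    _ = ((2 * Fintype.card κ) ^ m * (1 + 644 * m ^ 6 / Fintype.card V) +
        (Nat.card {w : Fin m → κ × Bool // IsRepetitive (wordCore (List.ofFn w))} : ℝ) *
          Fintype.card V ^ 2) * QB := by
        rw [Finset.sum_add_distrib, Finset.sum_const, ← Finset.sum_mul, Finset.sum_boole,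
          Finset.card_univ, nsmul_eq_mul, Nat.card_eq_fintype_card, Fintype.card_subtype,
          Fintype.card_pi_const, Fintype.card_prod, Fintype.card_bool]
        push_cast
        ring
    _ ≤ _ := by
        gcongr
        exact card_repetitive_words_le hq hq1 hq2 m

end WordTrace

section Spectral

theorem opNorm_pow_le_trace {n : Type*} [Fintype n] [DecidableEq n] [Nonempty n] {M : Matrix n n ℂ}
    (hM : M.IsHermitian) {m : ℕ} (hm : Even m) : opNorm M ^ m ≤ (M ^ m).trace.re := by
  open scoped Matrix.Norms.L2Operator in
  have h1 : opNorm M = ‖hM.eigenvalues‖ := by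
    rw [opNorm, Matrix.l2_opNorm_toEuclideanCLM]
    conv_lhs => rw [hM.spectral_theorem]
    rw [Unitary.conjStarAlgAut_apply, ← Unitary.coe_star, CStarRing.norm_mul_coe_unitary,
      CStarRing.norm_coe_unitary_mul,
      Matrix.l2_opNorm_diagonal]
    simp [Pi.norm_def]
  have h2 : (M ^ m).trace.re = ∑ i, hM.eigenvalues i ^ m := by
    have : M ^ m = Unitary.conjStarAlgAut ℂ _ hM.eigenvectorUnitary
        (Matrix.diagonal (RCLike.ofReal ∘ hM.eigenvalues) ^ m) := by
      rw [map_pow, ← hM.spectral_theorem]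
    rw [this, Unitary.conjStarAlgAut_apply, Matrix.trace_mul_comm, ← mul_assoc]
    simp [Matrix.diagonal_pow, Matrix.trace, ← Complex.ofReal_pow]
  obtain ⟨i, hi⟩ : ∃ i, ‖hM.eigenvalues‖ = |hM.eigenvalues i| := by
    obtain ⟨i, -, hi⟩ := Finset.exists_mem_eq_sup Finset.univ Finset.univ_nonempty
      fun i => ‖hM.eigenvalues i‖₊
    exact ⟨i, by rw [Pi.norm_def, hi]; simp⟩
  rw [h1, h2, hi, hm.pow_abs]
  exact Finset.single_le_sum (f := fun i => hM.eigenvalues i ^ m)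
    (fun j _ => hm.pow_nonneg _) (Finset.mem_univ i)

theorem sum_pow_eq_sum_prod_ofFn {α R : Type*} [Fintype α] [Semiring R] (X : α → R) (m : ℕ) :
    (∑ p, X p) ^ m = ∑ w : Fin m → α, ((List.ofFn w).map X).prod := by
  induction m with
  | zero => simp
  | succ m ih =>
    rw [sum_fin_succ_ofFn fun L => (L.map X).prod, pow_succ', ih, Finset.sum_mul]
    simp [Finset.mul_sum]

theorem prod_map_kronecker {α n R : Type*} [Fintype n] [DecidableEq n] [CommSemiring R]
    (A : α → Matrix n n R) (L : List α) :
    (L.map fun p => A p ⊗ₖ A p).prod = (L.map A).prod ⊗ₖ (L.map A).prod := by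
  induction L with
  | nil => simp
  | cons p L ih => simp [ih, Matrix.mul_kronecker_mul]

theorem sub_pow_of_absorb {R : Type*} [Ring R] {E φ : R} (h1 : E * φ = φ) (h2 : φ * E = φ)
    (h3 : φ * φ = φ) (m : ℕ) : (E - φ) ^ (m + 1) = E ^ (m + 1) - φ := by
  induction m with
  | zero => simp
  | succ m ih =>
    have h4 : E ^ (m + 1) * φ = φ := by
      clear ih
      induction m with
      | zero => simpa
      | succ m ih => rw [pow_succ, mul_assoc, h1, ih]
    rw [pow_succ, ih, pow_succ E (m + 1)]
    simp only [sub_mul, mul_sub, h2, h3, h4]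
    abel

end Spectral

section QuantumMap

variable {N D : ℕ} (πs : Fin (D / 2) → Equiv.Perm (Fin N)) (bs : Fin (D / 2) → Fin N → Bool)

theorem Amat_eq_letterMat (p : Fin (D / 2) × Bool) : Amat N D πs bs p =
    ((Real.sqrt D : ℝ) : ℂ)⁻¹ • (letterMat πs bs (flipLetter p)).map Complex.ofRealHom := by
  rw [Amat]
  congr 1
  ext i j
  rcases p with ⟨s, β⟩
  cases β
  · simp only [signDiag, permMat, letterMat, flipLetter, act, bitSign, Matrix.map_apply,
      Matrix.of_apply]
    by_cases h : πs s j = i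
    · cases h2 : bs s j <;> simp [Equiv.symm_apply_eq, h, h2]
    · simp [Equiv.symm_apply_eq, h, Ne.symm h]
  · simp only [signDiag, permMat, letterMat, flipLetter, act, bitSign, Matrix.map_apply,
      Matrix.of_apply]
    by_cases h : πs s i = j
    · cases h2 : bs s i <;> simp [Equiv.symm_apply_eq, h, h2]
    · simp [Equiv.symm_apply_eq, h, Ne.symm h]

theorem letterMat_transpose {κ V : Type*} [DecidableEq V] (π : κ → Equiv.Perm V) (b : κ → V → Bool)
    (p : κ × Bool) : (letterMat π b p)ᵀ = letterMat π b (flipLetter p) := by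
  ext i j
  rcases p with ⟨s, β⟩
  cases β
  · exact if_congr (eq_comm.trans (Equiv.Perm.inv_eq_iff_eq (f := π s)).symm) rfl rfl
  · exact if_congr ((Equiv.Perm.inv_eq_iff_eq (f := π s)).trans eq_comm) rfl rfl

theorem Amat_transpose (p : Fin (D / 2) × Bool) :
    (Amat N D πs bs p)ᵀ = Amat N D πs bs (flipLetter p) := by
  rw [Amat_eq_letterMat, Amat_eq_letterMat, Matrix.transpose_smul, ← Matrix.transpose_map,
    letterMat_transpose]

theorem Amat_conjTranspose (p : Fin (D / 2) × Bool) :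
    (Amat N D πs bs p)ᴴ = Amat N D πs bs (flipLetter p) := by
  rw [← Amat_transpose, Amat_eq_letterMat]
  ext i j
  simp

theorem Amat_mul_transpose (hD : 0 < D) (p : Fin (D / 2) × Bool) :
    Amat N D πs bs p * (Amat N D πs bs p)ᵀ = (D : ℂ)⁻¹ • 1 := by
  rw [Amat_transpose, Amat_eq_letterMat, Amat_eq_letterMat, smul_mul_smul_comm, ← Matrix.map_mul,
    letterMat_mul_flip, ← mul_inv, ← Complex.ofReal_mul, Real.mul_self_sqrt (by positivity)]
  simp

/-- The matrix of the quantum operation with Kraus operators `Amat`. -/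
def quantumMap (πs : Fin (D / 2) → Equiv.Perm (Fin N)) (bs : Fin (D / 2) → Fin N → Bool) :
    Matrix (Fin N × Fin N) (Fin N × Fin N) ℂ :=
  ∑ p : Fin (D / 2) × Bool, Amat N D πs bs p ⊗ₖ Amat N D πs bs p

theorem sum_flipLetter {κ M : Type*} [Fintype κ] [AddCommMonoid M] (f : κ × Bool → M) :
    ∑ p, f (flipLetter p) = ∑ p, f p :=
  Equiv.sum_comp (Function.Involutive.toPerm flipLetter flipLetter_flipLetter) f

theorem quantumMap_transpose : (quantumMap πs bs)ᵀ = quantumMap πs bs := by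
  rw [quantumMap, Matrix.transpose_sum, ← sum_flipLetter]
  refine Finset.sum_congr rfl fun p _ => ?_
  rw [← Matrix.kroneckerMap_transpose, Amat_transpose, flipLetter_flipLetter]

theorem quantumMap_isHermitian : (quantumMap πs bs).IsHermitian := by
  rw [Matrix.IsHermitian, quantumMap, Matrix.conjTranspose_sum, ← sum_flipLetter]
  refine Finset.sum_congr rfl fun p _ => ?_
  rw [Matrix.conjTranspose_kronecker, Amat_conjTranspose, flipLetter_flipLetter]

theorem phi1Proj_transpose : (phi1Proj N)ᵀ = phi1Proj N := by
  ext p q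
  simp [phi1Proj, and_comm]

theorem phi1Proj_isHermitian : (phi1Proj N).IsHermitian := by
  ext p q
  by_cases h1 : p.1 = p.2 <;> by_cases h2 : q.1 = q.2 <;> simp [phi1Proj, h1, h2]

theorem mul_phi1Proj_apply (M : Matrix (Fin N × Fin N) (Fin N × Fin N) ℂ) (p q : Fin N × Fin N) :
    (M * phi1Proj N) p q = if q.1 = q.2 then (∑ i, M p (i, i)) * (N : ℂ)⁻¹ else 0 := by
  rw [Matrix.mul_apply, Fintype.sum_prod_type]
  split_ifs with h
  · simp [phi1Proj, h, Finset.sum_mul]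
  · simp [phi1Proj, h]

theorem phi1Proj_mul_self (hN : N ≠ 0) : phi1Proj N * phi1Proj N = phi1Proj N := by
  have hN' : (N : ℂ) ≠ 0 := by exact_mod_cast hN
  ext p q
  rw [mul_phi1Proj_apply]
  by_cases h1 : p.1 = p.2 <;> by_cases h2 : q.1 = q.2 <;> simp [phi1Proj, h1, h2, hN']

theorem trace_phi1Proj (hN : N ≠ 0) : (phi1Proj N).trace = 1 := by
  have hN' : (N : ℂ) ≠ 0 := by exact_mod_cast hN
  rw [Matrix.trace, Fintype.sum_prod_type]
  simp [phi1Proj, hN']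

theorem quantumMap_mul_phi1Proj (hD : 0 < D) (hDe : Even D) :
    quantumMap πs bs * phi1Proj N = phi1Proj N := by
  have hD' : (D : ℂ) ≠ 0 := by exact_mod_cast hD.ne'
  have hcard : ((D / 2 : ℕ) : ℂ) * 2 = D := by
    exact_mod_cast Nat.div_mul_cancel hDe.two_dvd
  ext p q
  have key : ∑ i, quantumMap πs bs p (i, i) = if p.1 = p.2 then 1 else 0 := by
    have h (r : Fin (D / 2) × Bool) : ∑ i, (Amat N D πs bs r ⊗ₖ Amat N D πs bs r) p (i, i) =
        if p.1 = p.2 then (D : ℂ)⁻¹ else 0 := by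
      have := congr_fun (congr_fun (Amat_mul_transpose πs bs hD r) p.1) p.2
      rw [Matrix.mul_apply] at this
      simpa [Matrix.one_apply] using this
    simp only [quantumMap, Matrix.sum_apply]
    rw [Finset.sum_comm, Finset.sum_congr rfl fun r _ => h r, Finset.sum_const, Finset.card_univ]
    split_ifs
    · simp only [Fintype.card_prod, Fintype.card_fin, Fintype.card_bool, nsmul_eq_mul]
      push_cast
      rw [hcard, mul_inv_cancel₀ hD']
    · simp
  rw [mul_phi1Proj_apply, key]
  by_cases h1 : p.1 = p.2 <;> by_cases h2 : q.1 = q.2 <;> simp [phi1Proj, h1, h2]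

theorem phi1Proj_mul_quantumMap (hD : 0 < D) (hDe : Even D) :
    phi1Proj N * quantumMap πs bs = phi1Proj N := by
  have := congr_arg Matrix.transpose (quantumMap_mul_phi1Proj πs bs hD hDe)
  rwa [Matrix.transpose_mul, phi1Proj_transpose, quantumMap_transpose] at this

theorem trace_quantumMap_pow (m : ℕ) : (quantumMap πs bs ^ m).trace =
    ((((D : ℝ) ^ m)⁻¹ * ∑ w : Fin m → Fin (D / 2) × Bool, wordTrace πs bs (List.ofFn w) ^ 2 : ℝ) :
      ℂ) := by
  have hprod (L : List (Fin (D / 2) × Bool)) : (L.map (Amat N D πs bs)).prod =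
      (((Real.sqrt D : ℝ) : ℂ)⁻¹ ^ L.length) •
        (((L.map flipLetter).map (letterMat πs bs)).prod).map Complex.ofRealHom := by
    induction L with
    | nil => simp
    | cons p L ih =>
      simp only [List.map_cons, List.prod_cons, ih, Amat_eq_letterMat, smul_mul_smul_comm,
        List.length_cons, Matrix.map_mul, pow_succ']
  have htr (L : List (Fin (D / 2) × Bool)) :
      ((L.map fun p => Amat N D πs bs p ⊗ₖ Amat N D πs bs p).prod).trace =
        (((D : ℝ) ^ L.length)⁻¹ * wordTrace πs bs (L.map flipLetter) ^ 2 : ℝ) := by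
    have hmap (X : Matrix (Fin N) (Fin N) ℝ) :
        (X.map Complex.ofRealHom).trace = (X.trace : ℂ) := by
      simp [Matrix.trace]
    have hsq : (((Real.sqrt D : ℝ) : ℂ)⁻¹) ^ 2 = (D : ℂ)⁻¹ := by
      rw [inv_pow, ← Complex.ofReal_pow, Real.sq_sqrt (by positivity)]
      simp
    rw [prod_map_kronecker, Matrix.trace_kronecker, hprod, Matrix.trace_smul, hmap, ← wordTrace,
      smul_eq_mul, ← pow_two, mul_pow, ← pow_mul, mul_comm L.length, pow_mul, hsq]
    push_cast
    rw [inv_pow]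
  rw [quantumMap, sum_pow_eq_sum_prod_ofFn, Matrix.trace_sum, Finset.sum_congr rfl fun w _ => htr _,
    Finset.mul_sum, Complex.ofReal_sum]
  simp only [List.length_ofFn, List.map_ofFn]
  exact Equiv.sum_comp (Equiv.arrowCongr (Equiv.refl (Fin m))
    (Function.Involutive.toPerm flipLetter flipLetter_flipLetter))
    fun w => ((((D : ℝ) ^ m)⁻¹ * wordTrace πs bs (List.ofFn w) ^ 2 : ℝ) : ℂ)

theorem lamOf_pow_le (hN : N ≠ 0) (hD : 0 < D) (hDe : Even D) {m : ℕ} (hm : Even m) (hm0 : m ≠ 0) :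
    lamOf N D πs bs ^ m ≤
      ((D : ℝ) ^ m)⁻¹ * ∑ w : Fin m → Fin (D / 2) × Bool, wordTrace πs bs (List.ofFn w) ^ 2 - 1 := by
  have : NeZero N := ⟨hN⟩
  have hH : (quantumMap πs bs - phi1Proj N).IsHermitian :=
    (quantumMap_isHermitian πs bs).sub phi1Proj_isHermitian
  refine (opNorm_pow_le_trace hH hm).trans_eq ?_
  obtain ⟨k, rfl⟩ := Nat.exists_eq_succ_of_ne_zero hm0
  rw [Nat.succ_eq_add_one, sub_pow_of_absorb (quantumMap_mul_phi1Proj πs bs hD hDe)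
    (phi1Proj_mul_quantumMap πs bs hD hDe) (phi1Proj_mul_self hN), Matrix.trace_sub,
    trace_phi1Proj hN, trace_quantumMap_pow, Complex.sub_re, Complex.ofReal_re, Complex.one_re]

end QuantumMap

section Tail

theorem card_div_card_le_of_sum_pow_le {α : Type*} [Fintype α] [Nonempty α] {f : α → ℝ} {B t : ℝ}
    {m : ℕ} (hf : ∀ x, 0 ≤ f x) (ht : 0 < t) (hB : ∑ x, f x ^ m ≤ B * Fintype.card α) :
    (Nat.card {x // t ≤ f x} : ℝ) / Nat.card α ≤ B / t ^ m := by
  classical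
  have hcard : (0 : ℝ) < Fintype.card α := by exact_mod_cast Fintype.card_pos
  rw [Nat.card_eq_fintype_card, Nat.card_eq_fintype_card, Fintype.card_subtype,
    div_le_div_iff₀ hcard (by positivity)]
  refine le_trans ?_ hB
  rw [← nsmul_eq_mul]
  refine (Finset.card_nsmul_le_sum _ (fun x => f x ^ m) _ fun x hx => ?_).trans
    (Finset.sum_le_sum_of_subset_of_nonneg (Finset.filter_subset _ _)
      fun x _ _ => pow_nonneg (hf x) m)
  exact pow_le_pow_left₀ ht.le (Finset.mem_filter.1 hx).2 m

variable {N D : ℕ}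

theorem lamOf_nonneg (πs : Fin (D / 2) → Equiv.Perm (Fin N)) (bs : Fin (D / 2) → Fin N → Bool) :
    0 ≤ lamOf N D πs bs := norm_nonneg _

theorem lamOf_le (hN : N ≠ 0) (hD : 0 < D) (hDe : Even D)
    (πs : Fin (D / 2) → Equiv.Perm (Fin N)) (bs : Fin (D / 2) → Fin N → Bool) :
    lamOf N D πs bs ≤ N := by
  refine le_of_sq_le_sq ?_ (by positivity)
  have hD' : (0 : ℝ) < D := by exact_mod_cast hD
  have hcard : ((D / 2 : ℕ) : ℝ) * 2 = D := by exact_mod_cast Nat.div_mul_cancel hDe.two_dvd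
  calc lamOf N D πs bs ^ 2 ≤ _ := lamOf_pow_le πs bs hN hD hDe even_two two_ne_zero
    _ ≤ ((D : ℝ) ^ 2)⁻¹ * ∑ _w : Fin 2 → Fin (D / 2) × Bool, (N : ℝ) ^ 2 := by
      refine (sub_le_self _ zero_le_one).trans ?_
      refine mul_le_mul_of_nonneg_left (Finset.sum_le_sum fun w _ => ?_) (by positivity)
      exact (wordTrace_sq_le πs bs (List.ofFn w)).trans_eq (by rw [Fintype.card_fin])
    _ = (N : ℝ) ^ 2 := by
      rw [Finset.sum_const, Finset.card_univ, nsmul_eq_mul, Fintype.card_pi_const,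
        Fintype.card_prod, Fintype.card_bool, Fintype.card_fin]
      push_cast
      rw [hcard, inv_mul_cancel_left₀ (by positivity)]

theorem sum_lamOf_pow_le (hD : 4 ≤ D) (hDe : Even D) {m : ℕ} (hm : Even m) (hm0 : m ≠ 0)
    (hmN : 8 * m ≤ N) :
    ∑ x : (Fin (D / 2) → Equiv.Perm (Fin N)) × (Fin (D / 2) → Fin N → Bool),
        lamOf N D x.1 x.2 ^ m ≤
      (644 * m ^ 6 / N + 4 * (m + 1) ^ 3 * lamH D ^ m * N ^ 2) *
        Fintype.card ((Fin (D / 2) → Equiv.Perm (Fin N)) × (Fin (D / 2) → Fin N → Bool)) := by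
  have hN : N ≠ 0 := by omega
  have hD4 : (4 : ℝ) ≤ D := by exact_mod_cast hD
  have hcard : 2 * ((D / 2 : ℕ) : ℝ) = D := by exact_mod_cast Nat.mul_div_cancel' hDe.two_dvd
  have : Nonempty (Fin (D / 2)) := ⟨⟨0, by omega⟩⟩
  have hs : 1 ≤ Real.sqrt ((D : ℝ) - 1) := Real.one_le_sqrt.2 (by linarith)
  have hsq : Real.sqrt ((D : ℝ) - 1) ^ 2 = D - 1 := Real.sq_sqrt (by linarith)
  have hmom := sum_sq_wordTrace_le (κ := Fin (D / 2)) (V := Fin N)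
    (q := (Real.sqrt ((D : ℝ) - 1))⁻¹) (by positivity) (inv_le_one_of_one_le₀ hs)
    (by rw [Fintype.card_fin, hcard, inv_pow, hsq, mul_inv_cancel₀ (by linarith)])
    (m := m) (by simpa using hmN)
  rw [Fintype.sum_prod_type]
  set QB : ℝ := Fintype.card (Fin (D / 2) → Equiv.Perm (Fin N)) *
    Fintype.card (Fin (D / 2) → Fin N → Bool) with hQB
  rw [inv_inv, Fintype.card_fin, Fintype.card_fin, hcard] at hmom
  have hone : ∑ _π : Fin (D / 2) → Equiv.Perm (Fin N), ∑ _b : Fin (D / 2) → Fin N → Bool, (1 : ℝ) =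
      QB := by
    simp [hQB]
  calc _ ≤ ∑ π : Fin (D / 2) → Equiv.Perm (Fin N), ∑ b : Fin (D / 2) → Fin N → Bool,
        (((D : ℝ) ^ m)⁻¹ * ∑ w : Fin m → Fin (D / 2) × Bool, wordTrace π b (List.ofFn w) ^ 2 - 1) :=
        Finset.sum_le_sum fun π _ => Finset.sum_le_sum fun b _ =>
          lamOf_pow_le π b hN (by omega) hDe hm hm0
    _ = ((D : ℝ) ^ m)⁻¹ * (∑ π : Fin (D / 2) → Equiv.Perm (Fin N),
        ∑ b : Fin (D / 2) → Fin N → Bool, ∑ w : Fin m → Fin (D / 2) × Bool,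
          wordTrace π b (List.ofFn w) ^ 2) - QB := by
        simp only [Finset.sum_sub_distrib, ← Finset.mul_sum, hone]
    _ ≤ ((D : ℝ) ^ m)⁻¹ * (((D : ℝ) ^ m * (1 + 644 * m ^ 6 / N) +
        4 * (m + 1) ^ 3 * (2 * Real.sqrt ((D : ℝ) - 1)) ^ m * N ^ 2) * QB) - QB := by
        gcongr
    _ = _ := by
        rw [Fintype.card_prod, lamH, div_pow]
        push_cast
        rw [← hQB]
        have : (D : ℝ) ^ m ≠ 0 := by positivity
        field_simp
        ring

theorem lamH_mem_Ioo (hD : 4 ≤ D) : lamH D ∈ Set.Ioo (0 : ℝ) 1 := by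
  have hD4 : (4 : ℝ) ≤ D := by exact_mod_cast hD
  have hs : 0 < Real.sqrt ((D : ℝ) - 1) := Real.sqrt_pos.2 (by linarith)
  have hsq : Real.sqrt ((D : ℝ) - 1) ^ 2 = D - 1 := Real.sq_sqrt (by linarith)
  refine ⟨by rw [lamH]; positivity, ?_⟩
  rw [lamH, div_lt_one (by linarith)]
  nlinarith [sq_nonneg (Real.sqrt ((D : ℝ) - 1) - 1)]

theorem one_lt_log_of_three_le {x : ℝ} (hx : 3 ≤ x) : 1 < Real.log x := by
  rw [Real.lt_log_iff_exp_lt (by linarith)]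
  exact (Real.exp_one_lt_d9.trans (by norm_num)).trans_le hx

theorem exp_half_le_one_add {z : ℝ} (h0 : 0 ≤ z) (h1 : z ≤ 1) : Real.exp (z / 2) ≤ 1 + z := by
  rw [← Real.le_log_iff_exp_le (by linarith)]
  refine le_trans ?_ (Real.one_sub_inv_le_log_of_pos (by linarith))
  have : 1 - (1 + z)⁻¹ = z / (1 + z) := by
    field_simp
    ring
  rw [this]
  gcongr
  linarith

theorem div_exp_le_rpow_add_pow {h K' C l : ℝ} {m : ℕ} (h0 : 0 < h) (h1 : h < 1) (hK'0 : 0 < K')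
    (hl2 : 2 ≤ l)
    (hC : 2 * Real.log (1 / h) / 3 * (6 + 2 * |Real.log K'| + 2 * Real.log (1 / h)) ≤ C)
    (hz : C * Real.log l / l ≤ 1) (hrm : 3 * l / Real.log (1 / h) ≤ m)
    (hmr : (m : ℝ) ≤ 3 * l / Real.log (1 / h) + 2) :
    K' * l ^ 6 / Real.exp l ≤ (h ^ ((1 : ℝ) / 3) + C * Real.log l / l) ^ m := by
  have hL0 : 0 < Real.log (1 / h) := Real.log_pos ((one_lt_div h0).2 h1)
  have hlogh : Real.log h = -Real.log (1 / h) := by rw [one_div, Real.log_inv, neg_neg]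
  generalize Real.log (1 / h) = L at *
  have hll : 1 / 2 ≤ Real.log l := by
    have := Real.log_le_log two_pos hl2
    linarith [Real.log_two_gt_d9]
  have hC0 : 0 < C := lt_of_lt_of_le (by positivity) hC
  have hz0 : 0 ≤ C * Real.log l / l := by positivity
  have hrz : 3 * l / L * (C * Real.log l / l) = 3 * C / L * Real.log l := by field_simp
  have hrL : 3 * l / L * L = 3 * l := by field_simp
  generalize C * Real.log l / l = z at *
  generalize 3 * l / L = r at *
  have hX : Real.exp (-L / 3 + z / 2) ≤ h ^ ((1 : ℝ) / 3) + z := by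
    have hroot : h ^ ((1 : ℝ) / 3) = Real.exp (-L / 3) := by
      rw [Real.rpow_def_of_pos h0, hlogh]
      ring_nf
    have hroot1 : h ^ ((1 : ℝ) / 3) ≤ 1 := Real.rpow_le_one h0.le h1.le (by norm_num)
    have hroot0 : 0 ≤ h ^ ((1 : ℝ) / 3) := by positivity
    rw [Real.exp_add, ← hroot]
    calc _ ≤ h ^ ((1 : ℝ) / 3) * (1 + z) :=
          mul_le_mul_of_nonneg_left (exp_half_le_one_add hz0 hz) hroot0
      _ ≤ _ := by nlinarith
  refine le_trans ?_ (pow_le_pow_left₀ (Real.exp_pos _).le hX m)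
  have hlhs : K' * l ^ 6 / Real.exp l = Real.exp (Real.log K' + 6 * Real.log l - l) := by
    rw [Real.exp_sub, Real.exp_add, Real.exp_log hK'0, ← Real.rpow_natCast,
      Real.rpow_def_of_pos (by linarith)]
    push_cast
    ring_nf
  rw [hlhs, ← Real.exp_nat_mul, Real.exp_le_exp]
  have hC1 : 6 + 2 * |Real.log K'| + 2 * L ≤ 3 * C / L / 2 := by
    rw [div_div, le_div_iff₀ (by positivity)]
    linarith
  have h2 := mul_le_mul_of_nonneg_right hC1 (by linarith : 0 ≤ Real.log l)
  have h3 : |Real.log K'| + L ≤ (2 * |Real.log K'| + 2 * L) * Real.log l := by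
    nlinarith [abs_nonneg (Real.log K')]
  have h4 := le_abs_self (Real.log K')
  have h5 := mul_le_mul_of_nonneg_right hrm hz0
  have h7 : m * L ≤ 3 * l + 2 * L := by nlinarith
  linarith

/-- Choice of the constant and of the exponent in the moment method. -/
theorem exists_const_exponent {h : ℝ} (h0 : 0 < h) (h1 : h < 1) :
    ∃ C N₀ : ℝ, 0 < C ∧
      (∀ N : ℕ, 3 ≤ N → (N : ℝ) < N₀ → (N : ℝ) < C * Real.log (Real.log N) / Real.log N) ∧
      ∀ N : ℕ, 3 ≤ N → N₀ ≤ N → ∃ m : ℕ, Even m ∧ m ≠ 0 ∧ 8 * m ≤ N ∧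
        3 * Real.log N / Real.log (1 / h) ≤ m ∧
        644 * (m : ℝ) ^ 6 / N + 4 * (m + 1) ^ 3 * h ^ m * N ^ 2 ≤
          (h ^ ((1 : ℝ) / 3) + C * Real.log (Real.log N) / Real.log N) ^ m := by
  set L := Real.log (1 / h) with hL
  have hlogh : Real.log h = -L := by rw [hL, one_div, Real.log_inv, neg_neg]
  have hL0 : 0 < L := Real.log_pos ((one_lt_div h0).2 h1)
  set K : ℝ := 3 / L + 2 with hK
  have hK0 : 0 < K := by positivity
  set K' : ℝ := 644 * K ^ 6 + 4 * (K + 1) ^ 3 with hK'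
  have hK'0 : 0 < K' := by positivity
  have hev : ∀ᶠ x : ℝ in Filter.atTop,
      2 ≤ Real.log x ∧ 8 * K * Real.log x ≤ x ∧ K' * Real.log x ^ 6 ≤ x := by
    refine (Real.tendsto_log_atTop.eventually_ge_atTop 2).and (Filter.Eventually.and ?_ ?_)
    · filter_upwards [Real.isLittleO_log_id_atTop.bound (c := (8 * K)⁻¹) (by positivity),
        Filter.eventually_ge_atTop 1] with x hx hx1
      rw [id_eq, Real.norm_of_nonneg (Real.log_nonneg hx1), Real.norm_of_nonneg (by linarith)] at hx
      rwa [← le_inv_mul_iff₀ (by positivity)]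
    · filter_upwards [(Real.isLittleO_pow_log_id_atTop (n := 6)).bound (c := K'⁻¹) (by positivity),
        Filter.eventually_ge_atTop 1] with x hx hx1
      rw [id_eq, Real.norm_of_nonneg (pow_nonneg (Real.log_nonneg hx1) 6),
        Real.norm_of_nonneg (by linarith)] at hx
      rwa [← le_inv_mul_iff₀ (by positivity)]
  obtain ⟨N₀, hN₀⟩ := Filter.eventually_atTop.1 hev
  have hll3 : 0 < Real.log (Real.log 3) := Real.log_pos (one_lt_log_of_three_le le_rfl)
  set C₁ : ℝ := 2 * L / 3 * (6 + 2 * |Real.log K'| + 2 * L) with hC₁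
  have hC₁0 : 0 < C₁ := by positivity
  refine ⟨C₁ + N₀ ^ 2 / Real.log (Real.log 3), N₀, by positivity, fun N hN hlt => ?_,
    fun N hN hle => ?_⟩
  · have hN3 : (3 : ℝ) ≤ N := by exact_mod_cast hN
    have hl := one_lt_log_of_three_le hN3
    have hmono : Real.log (Real.log 3) ≤ Real.log (Real.log N) :=
      Real.log_le_log (by linarith [one_lt_log_of_three_le le_rfl])
        (Real.log_le_log (by norm_num) hN3)
    rw [lt_div_iff₀ (by linarith)]
    have hlN : Real.log N ≤ N := Real.log_le_self (by linarith)
    calc (N : ℝ) * Real.log N ≤ N * N := by gcongr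
      _ < N₀ ^ 2 := by nlinarith
      _ = N₀ ^ 2 / Real.log (Real.log 3) * Real.log (Real.log 3) := by field_simp
      _ ≤ (C₁ + N₀ ^ 2 / Real.log (Real.log 3)) * Real.log (Real.log N) := by
        gcongr
        linarith
  · set C : ℝ := C₁ + N₀ ^ 2 / Real.log (Real.log 3) with hC
    have hCC : C₁ ≤ C := le_add_of_nonneg_right (by positivity)
    have hC0 : 0 < C := hC₁0.trans_le hCC
    have hN3 : (3 : ℝ) ≤ N := by exact_mod_cast hN
    obtain ⟨hl2, h8, h6⟩ := hN₀ N hle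
    set l := Real.log N with hl
    have hexpl : Real.exp l = N := Real.exp_log (by linarith)
    set r : ℝ := 3 * l / L with hr
    have hr0 : 0 < r := by positivity
    have hrL : r * L = 3 * l := by rw [hr]; field_simp
    obtain ⟨m, hme, hm0, hrm, hmr⟩ : ∃ m : ℕ, Even m ∧ m ≠ 0 ∧ r ≤ m ∧ (m : ℝ) ≤ r + 2 := by
      have h1 := Nat.le_ceil (r / 2)
      have h2 := Nat.ceil_lt_add_one (a := r / 2) (by positivity)
      have h3 : 0 < ⌈r / 2⌉₊ := Nat.ceil_pos.2 (by positivity)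
      refine ⟨2 * ⌈r / 2⌉₊, even_two_mul _, by omega, ?_, ?_⟩ <;> push_cast <;> linarith
    have hmK : (m : ℝ) ≤ K * l := by
      refine hmr.trans ?_
      rw [hK, hr, add_mul, div_mul_eq_mul_div]
      linarith
    refine ⟨m, hme, hm0, ?_, hrm, ?_⟩
    · have : (8 : ℝ) * m ≤ N := by nlinarith
      exact_mod_cast this
    have hhm : h ^ m ≤ ((N : ℝ) ^ 3)⁻¹ := by
      rw [← Real.exp_log h0, ← Real.exp_nat_mul, hlogh, ← hexpl, ← Real.exp_nat_mul, ← Real.exp_neg]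
      refine Real.exp_le_exp.2 ?_
      push_cast
      nlinarith
    have hB : 644 * (m : ℝ) ^ 6 / N + 4 * (m + 1) ^ 3 * h ^ m * N ^ 2 ≤ K' * l ^ 6 / N := by
      have hm1 : (m : ℝ) + 1 ≤ (K + 1) * l := by linarith
      calc _ ≤ 644 * (K * l) ^ 6 / N + 4 * ((K + 1) * l) ^ 3 * ((N : ℝ) ^ 3)⁻¹ * N ^ 2 := by
            gcongr
        _ = (644 * K ^ 6 * l ^ 6 + 4 * (K + 1) ^ 3 * l ^ 3) / N := by
            field_simp
        _ ≤ (644 * K ^ 6 * l ^ 6 + 4 * (K + 1) ^ 3 * l ^ 6) / N := by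
            gcongr
            · linarith
            · norm_num
        _ = _ := by rw [hK']; ring
    refine hB.trans ?_
    have hll : 1 / 2 ≤ Real.log l := by
      have := Real.log_le_log two_pos hl2
      linarith [Real.log_two_gt_d9]
    set z := C * Real.log l / l with hz
    have hz0 : 0 ≤ z := by positivity
    have hroot0 : 0 ≤ h ^ ((1 : ℝ) / 3) := by positivity
    rcases le_or_gt z 1 with hz1 | hz1
    · rw [← hexpl]
      exact div_exp_le_rpow_add_pow h0 h1 hK'0 hl2 hCC hz1 hrm hmr
    · calc K' * l ^ 6 / N ≤ 1 := div_le_one_of_le₀ h6 (by linarith)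
        _ ≤ _ := one_le_pow₀ (by linarith)

end Tail

/-- Random permutations with random diagonal signs give quantum expanders:
for every even D ≥ 4 there is C > 0 such that for all N ≥ 3 and c > 1, the
probability (over uniform permutations and signs) that
λ ≥ c(λ_H^{1/3} + C·log log N/log N) is at most c^{−3 log N/log(1/λ_H)}. -/
theorem stmt4 (D : ℕ) (hD : 4 ≤ D) (hDeven : Even D) :
    ∃ C : ℝ, 0 < C ∧
      ∀ (N : ℕ), 3 ≤ N → ∀ c : ℝ, 1 < c →
        ((Nat.card {x : (Fin (D / 2) → Equiv.Perm (Fin N)) × (Fin (D / 2) → Fin N → Bool) //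
            c * (lamH D ^ ((1 : ℝ) / 3) + C * Real.log (Real.log N) / Real.log N) ≤
              lamOf N D x.1 x.2} : ℝ) /
          (Nat.card ((Fin (D / 2) → Equiv.Perm (Fin N)) × (Fin (D / 2) → Fin N → Bool)) : ℝ)) ≤
        c ^ (-(3 * Real.log N / Real.log (1 / lamH D))) := by
  have hD0 : 0 < D := by omega
  obtain ⟨h0, h1⟩ := lamH_mem_Ioo hD
  obtain ⟨C, N₀, hC0, hsmall, hlarge⟩ := exists_const_exponent h0 h1
  refine ⟨C, hC0, fun N hN c hc => ?_⟩
  have hN0 : N ≠ 0 := by omega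
  have hN3 : (3 : ℝ) ≤ N := by exact_mod_cast hN
  have hl := one_lt_log_of_three_le hN3
  have hll : 0 < Real.log (Real.log N) := Real.log_pos hl
  have hroot : 0 < lamH D ^ ((1 : ℝ) / 3) := Real.rpow_pos_of_pos h0 _
  set X : ℝ := lamH D ^ ((1 : ℝ) / 3) + C * Real.log (Real.log N) / Real.log N with hX
  have hX0 : 0 < X := by positivity
  rcases lt_or_ge (N : ℝ) N₀ with hlt | hge
  · have hNX : (N : ℝ) < c * X := by
      have := hsmall N hN hlt
      nlinarith
    have : IsEmpty {x : (Fin (D / 2) → Equiv.Perm (Fin N)) × (Fin (D / 2) → Fin N → Bool) //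
        c * X ≤ lamOf N D x.1 x.2} :=
      ⟨fun ⟨x, hx⟩ => (hx.trans (lamOf_le hN0 hD0 hDeven x.1 x.2)).not_gt hNX⟩
    rw [Nat.card_of_isEmpty, Nat.cast_zero, zero_div]
    positivity
  · obtain ⟨m, hme, hm0, hmN, hrm, hB⟩ := hlarge N hN hge
    have hcX : 0 < c * X := mul_pos (by linarith) hX0
    have htail := card_div_card_le_of_sum_pow_le
      (f := fun x : (Fin (D / 2) → Equiv.Perm (Fin N)) × (Fin (D / 2) → Fin N → Bool) =>
        lamOf N D x.1 x.2)
      (fun x => lamOf_nonneg x.1 x.2) hcX (sum_lamOf_pow_le hD hDeven hme hm0 hmN)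
    refine htail.trans ?_
    calc _ ≤ X ^ m / (c * X) ^ m := by gcongr
      _ = c ^ (-(m : ℝ)) := by
        rw [mul_pow, Real.rpow_neg (by linarith), Real.rpow_natCast]
        field_simp
      _ ≤ _ := Real.rpow_le_rpow_of_exponent_le hc.le (neg_le_neg hrm)

end
end

section
/- Let Π, X, Y be linear operators on a finite-dimensional complex inner product space, with Π an orthogonal projection (Π² = Π = Π†). Assume ‖X‖ ≤ 1, ‖Y‖ ≤ 1, ΠX = XΠ = Π, ‖(I−Π)X(I−Π)‖ ≤ 1 − ε_X, and ‖ΠYΠ‖ ≤ 1 − ε_Y, where 0 < ε_X < 1 and 0 < ε_Y < 1. Then for any 0 < p < 1, ‖pX + (1−p)Y‖ ≤ 1 − (ε_Y/12)·min(p·ε_X, 1−p); in particular ‖pX + (1−p)Y‖ < 1. -/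
noncomputable section

section MixingHelpers

variable {E : Type*} [NormedAddCommGroup E] [InnerProductSpace ℂ E]

lemma re_inner_apply_le_of_norm_le {T : E →L[ℂ] E} {c : ℝ} (hT : ‖T‖ ≤ c) (v u : E) :
    (inner ℂ v (T u)).re ≤ c * (‖v‖ * ‖u‖) := by
  have h1 : (inner ℂ v (T u)).re ≤ ‖v‖ * ‖T u‖ := re_inner_le_norm (𝕜 := ℂ) v (T u)
  have h2 : ‖T u‖ ≤ c * ‖u‖ := T.le_of_opNorm_le hT u
  nlinarith [mul_le_mul_of_nonneg_left h2 (norm_nonneg v)]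

lemma norm_le_of_two_mul_re_inner_le {T : E →L[ℂ] E} {c : ℝ} (hc : 0 ≤ c)
    (h : ∀ v u : E, 2 * (inner ℂ v (T u)).re ≤ c * (‖u‖ ^ 2 + ‖v‖ ^ 2)) : ‖T‖ ≤ c := by
  refine T.opNorm_le_bound hc fun u => ?_
  rcases (norm_nonneg (T u)).eq_or_lt with h0 | h0
  · rw [← h0]
    positivity
  rcases (norm_nonneg u).eq_or_lt with hu | hu
  · have : u = 0 := norm_eq_zero.mp hu.symm
    simp [this]
  have key := h (((‖u‖ / ‖T u‖ : ℝ) : ℂ) • T u) u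
  have hin : (inner ℂ (((‖u‖ / ‖T u‖ : ℝ) : ℂ) • T u) (T u)).re = ‖u‖ * ‖T u‖ := by
    rw [inner_smul_left, Complex.conj_ofReal, Complex.re_ofReal_mul]
    have : (inner ℂ (T u) (T u)).re = ‖T u‖ ^ 2 := inner_self_eq_norm_sq (𝕜 := ℂ) (T u)
    rw [this]
    field_simp
  have hn : ‖((‖u‖ / ‖T u‖ : ℝ) : ℂ) • T u‖ = ‖u‖ := by
    rw [norm_smul, Complex.norm_real, Real.norm_of_nonneg (by positivity)]
    field_simp
  rw [hin, hn] at key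
  have : ‖u‖ * ‖T u‖ ≤ ‖u‖ * (c * ‖u‖) := by nlinarith
  exact le_of_mul_le_mul_left this hu

/-- The form `‖u‖² + ‖v‖² - 2 Re ⟪v, Y u⟫` attached to an operator `Y`. -/
def contractionForm (Y : E →L[ℂ] E) (u v : E) : ℝ :=
  ‖u‖ ^ 2 + ‖v‖ ^ 2 - 2 * (inner ℂ v (Y u)).re

lemma contractionForm_nonneg {Y : E →L[ℂ] E} (hY : ‖Y‖ ≤ 1) (u v : E) :
    0 ≤ contractionForm Y u v := by
  have := re_inner_apply_le_of_norm_le hY v u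
  unfold contractionForm
  nlinarith [sq_nonneg (‖u‖ - ‖v‖)]

lemma contractionForm_le {Y : E →L[ℂ] E} (hY : ‖Y‖ ≤ 1) (u v : E) :
    contractionForm Y u v ≤ 2 * (‖u‖ ^ 2 + ‖v‖ ^ 2) := by
  have := re_inner_apply_le_of_norm_le hY (-v) u
  rw [inner_neg_left, Complex.neg_re, norm_neg] at this
  unfold contractionForm
  nlinarith [sq_nonneg (‖u‖ - ‖v‖)]

lemma contractionForm_add_add_sub (Y : E →L[ℂ] E) (u v s t : E) :
    contractionForm Y (u + s) (v + t) + contractionForm Y (u - s) (v - t) =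
      2 * contractionForm Y u v + 2 * contractionForm Y s t := by
  have h1 := parallelogram_law_with_norm ℂ u s
  have h2 := parallelogram_law_with_norm ℂ v t
  simp only [contractionForm, map_add, map_sub, inner_add_left, inner_add_right, inner_sub_left,
    inner_sub_right, Complex.add_re, Complex.sub_re]
  linarith

variable [CompleteSpace E]

lemma norm_sq_eq_add_of_projection {P : E →L[ℂ] E} (hidem : P ∘L P = P)
    (hadj : ContinuousLinearMap.adjoint P = P) (u : E) :
    ‖u‖ ^ 2 = ‖P u‖ ^ 2 + ‖u - P u‖ ^ 2 := by
  have hPP : P (P u) = P u := DFunLike.congr_fun hidem u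
  have h : inner ℂ (P u) (u - P u) = 0 := by
    have := ContinuousLinearMap.adjoint_inner_left P (u - P u) u
    rw [hadj] at this
    rw [this, map_sub, hPP, sub_self, inner_zero_right]
  have := norm_add_sq_eq_norm_sq_add_norm_sq_of_inner_eq_zero (P u) (u - P u) h
  rw [add_sub_cancel] at this
  nlinarith

lemma two_mul_re_inner_le_of_gap {P X : E →L[ℂ] E} (hidem : P ∘L P = P)
    (hadj : ContinuousLinearMap.adjoint P = P) (hPX : P ∘L X = P) (hXP : X ∘L P = P)
    {ε : ℝ} (hε : ε ≤ 1) (hgap : ‖(1 - P) ∘L X ∘L (1 - P)‖ ≤ 1 - ε) (v u : E) :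
    2 * (inner ℂ v (X u)).re ≤
      ‖u‖ ^ 2 + ‖v‖ ^ 2 - ε * (‖u - P u‖ ^ 2 + ‖v - P v‖ ^ 2) := by
  have hP (x : E) : P (P x) = P x := DFunLike.congr_fun hidem x
  have hPX' (x : E) : P (X x) = P x := DFunLike.congr_fun hPX x
  have hXP' (x : E) : X (P x) = P x := DFunLike.congr_fun hXP x
  have hT : ((1 - P) ∘L X ∘L (1 - P)) (u - P u) = X u - P u := by
    simp [hP, hPX', hXP']
  have hsa (x y : E) : inner ℂ (P x) y = inner ℂ x (P y) := by
    have := ContinuousLinearMap.adjoint_inner_left P y x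
    rwa [hadj] at this
  have hsplit : inner ℂ v (X u) = inner ℂ (P v) (P u) + inner ℂ (v - P v) (X u - P u) := by
    simp only [inner_sub_left, inner_sub_right, hsa, hP, hPX']
    ring
  have h1 : (inner ℂ (P v) (P u)).re ≤ ‖P v‖ * ‖P u‖ := re_inner_le_norm (𝕜 := ℂ) _ _
  have h2 := re_inner_apply_le_of_norm_le hgap (v - P v) (u - P u)
  rw [hT] at h2
  rw [hsplit, Complex.add_re]
  have hu := norm_sq_eq_add_of_projection hidem hadj u
  have hv := norm_sq_eq_add_of_projection hidem hadj v
  nlinarith [sq_nonneg (‖P v‖ - ‖P u‖),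
    mul_nonneg (sub_nonneg.mpr hε) (sq_nonneg (‖v - P v‖ - ‖u - P u‖))]

lemma mul_norm_sq_le_contractionForm {P Y : E →L[ℂ] E} (hidem : P ∘L P = P)
    (hadj : ContinuousLinearMap.adjoint P = P) (hY : ‖Y‖ ≤ 1)
    {ε : ℝ} (hε : ε ≤ 1) (hgap : ‖P ∘L Y ∘L P‖ ≤ 1 - ε) (v u : E) :
    ε * (‖u‖ ^ 2 + ‖v‖ ^ 2) ≤
      2 * contractionForm Y u v + 5 * (‖u - P u‖ ^ 2 + ‖v - P v‖ ^ 2) := by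
  have hP (x : E) : P (P x) = P x := DFunLike.congr_fun hidem x
  have hin : inner ℂ (P v) ((P ∘L Y ∘L P) (P u)) = inner ℂ (P v) (Y (P u)) := by
    have := ContinuousLinearMap.adjoint_inner_left P (Y (P u)) (P v)
    rw [hadj, hP] at this
    simp [hP, this]
  have h1 := re_inner_apply_le_of_norm_le hgap (P v) (P u)
  rw [hin] at h1
  have h2 := contractionForm_add_add_sub Y u v (u - P u) (v - P v)
  rw [sub_sub_cancel, sub_sub_cancel] at h2
  have h3 := contractionForm_nonneg hY (u + (u - P u)) (v + (v - P v))
  have h4 := contractionForm_le hY (u - P u) (v - P v)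
  have h5 : ε * (‖P u‖ ^ 2 + ‖P v‖ ^ 2) ≤ contractionForm Y (P u) (P v) := by
    unfold contractionForm
    nlinarith [mul_nonneg (sub_nonneg.mpr hε) (sq_nonneg (‖P v‖ - ‖P u‖))]
  have hu := norm_sq_eq_add_of_projection hidem hadj u
  have hv := norm_sq_eq_add_of_projection hidem hadj v
  nlinarith [mul_nonneg (sub_nonneg.mpr hε)
    (add_nonneg (sq_nonneg ‖u - P u‖) (sq_nonneg ‖v - P v‖))]

end MixingHelpers

/-- Mixing lemma: if X fixes the range of an orthogonal projection P, contracts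
on its complement, and Y contracts on the range of P, then any strict convex
combination pX + (1-p)Y has norm strictly below 1, quantitatively. -/
theorem stmt6 {E : Type*} [NormedAddCommGroup E] [InnerProductSpace ℂ E]
    [FiniteDimensional ℂ E]
    (P X Y : E →L[ℂ] E)
    (hidem : P ∘L P = P) (hadj : ContinuousLinearMap.adjoint P = P)
    (hX : ‖X‖ ≤ 1) (hY : ‖Y‖ ≤ 1)
    (hPX : P ∘L X = P) (hXP : X ∘L P = P)
    (εX εY : ℝ) (hεX0 : 0 < εX) (hεX1 : εX < 1) (hεY0 : 0 < εY) (hεY1 : εY < 1)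
    (hXgap : ‖(1 - P) ∘L X ∘L (1 - P)‖ ≤ 1 - εX)
    (hYgap : ‖P ∘L Y ∘L P‖ ≤ 1 - εY)
    (p : ℝ) (hp0 : 0 < p) (hp1 : p < 1) :
    ‖(p : ℂ) • X + ((1 - p : ℝ) : ℂ) • Y‖ ≤ 1 - εY / 12 * min (p * εX) (1 - p) ∧
      ‖(p : ℂ) • X + ((1 - p : ℝ) : ℂ) • Y‖ < 1 := by
  have : CompleteSpace E := FiniteDimensional.complete ℂ E
  set m := min (p * εX) (1 - p) with hm
  have hm0 : 0 < m := lt_min (by positivity) (by linarith)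
  have hm1 : m ≤ 1 - p := min_le_right _ _
  have hm2 : m ≤ p * εX := min_le_left _ _
  have hpos : 0 < εY / 12 * m := by positivity
  have hle : ‖(p : ℂ) • X + ((1 - p : ℝ) : ℂ) • Y‖ ≤ 1 - εY / 12 * m := by
    refine norm_le_of_two_mul_re_inner_le (by nlinarith) fun v u => ?_
    have h1 := two_mul_re_inner_le_of_gap hidem hadj hPX hXP hεX1.le hXgap v u
    have h2 := mul_norm_sq_le_contractionForm hidem hadj hY hεY1.le hYgap v u
    have h3 := contractionForm_nonneg hY u v
    have hin : (inner ℂ v (((p : ℂ) • X + ((1 - p : ℝ) : ℂ) • Y) u)).re =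
        p * (inner ℂ v (X u)).re + (1 - p) * (inner ℂ v (Y u)).re := by
      rw [add_apply, smul_apply, smul_apply, inner_add_right, inner_smul_right, inner_smul_right,
        Complex.add_re, Complex.re_ofReal_mul, Complex.re_ofReal_mul]
    have hq : 2 * (inner ℂ v (Y u)).re = ‖u‖ ^ 2 + ‖v‖ ^ 2 - contractionForm Y u v := by
      unfold contractionForm
      ring
    rw [hin]
    have hβ : 0 ≤ ‖u - P u‖ ^ 2 + ‖v - P v‖ ^ 2 := by positivity
    set β := ‖u - P u‖ ^ 2 + ‖v - P v‖ ^ 2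
    set q := contractionForm Y u v
    have h4 := mul_le_mul_of_nonneg_left h1 hp0.le
    have h5 := mul_le_mul_of_nonneg_right hm1 h3
    have h6 := mul_le_mul_of_nonneg_right hm2 hβ
    have h7 := mul_le_mul_of_nonneg_left h2 hm0.le
    have h8 := mul_nonneg hm0.le h3
    have h9 := mul_nonneg hm0.le hβ
    have h10 : 2 * ((1 - p) * (inner ℂ v (Y u)).re) =
        (1 - p) * (‖u‖ ^ 2 + ‖v‖ ^ 2 - q) := by rw [← hq]; ring
    linarith
  exact ⟨hle, by linarith⟩

end
end

section
/- Let N, k ≥ 1 and let Π_k := (1/N!)∑_{π∈S_N} P_π^{⊗k}, an N^k×N^k matrix. Then the rank of Π_k equals the number of partitions of the set {1,…,k} into at most N nonempty blocks. In particular, if N ≥ k, the rank equals the Bell number B_k, the total number of partitions of a k-element set. -/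
open scoped Matrix BigOperators

noncomputable section

/-- The k-fold Kronecker tensor power of a matrix. -/
def tensorPow {n : Type*} [Fintype n] (A : Matrix n n ℂ) (k : ℕ) :
    Matrix (Fin k → n) (Fin k → n) ℂ :=
  Matrix.of fun i j => ∏ a, A (i a) (j a)

/-- Π_k = (1/N!) ∑_{π ∈ S_N} P_π^{⊗k}. -/
def Pik (N k : ℕ) : Matrix (Fin k → Fin N) (Fin k → Fin N) ℂ :=
  ((N.factorial : ℂ))⁻¹ • ∑ π : Equiv.Perm (Fin N), tensorPow (permMat N π) k

theorem tensorPow_permMat_mulVec (N k : ℕ) (π : Equiv.Perm (Fin N)) (v : (Fin k → Fin N) → ℂ)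
    (i : Fin k → Fin N) : (tensorPow (permMat N π) k *ᵥ v) i = v (⇑π⁻¹ ∘ i) := by
  have entry (j : Fin k → Fin N) :
      tensorPow (permMat N π) k i j = if j = ⇑π⁻¹ ∘ i then 1 else 0 := by
    simp only [tensorPow, permMat, Matrix.of_apply, Fintype.prod_boole, funext_iff,
      Function.comp_apply, Equiv.Perm.eq_inv_iff_eq]
    congr
  simp [Matrix.mulVec, dotProduct, entry]

theorem Pik_mulVec (N k : ℕ) (v : (Fin k → Fin N) → ℂ) (i : Fin k → Fin N) :
    (Pik N k *ᵥ v) i =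
      (N.factorial : ℂ)⁻¹ * ∑ π : Equiv.Perm (Fin N), v (⇑π ∘ i) := by
  simp only [Pik, Matrix.smul_mulVec, Matrix.sum_mulVec, Pi.smul_apply, Finset.sum_apply,
    tensorPow_permMat_mulVec, smul_eq_mul]
  rw [← Equiv.sum_comp (Equiv.inv (Equiv.Perm (Fin N)))]
  simp

/-- A surjection whose fibres are the orbits of `S_N` on `(Fin N)^k` computes the rank of `Pik`. -/
theorem rank_Pik_eq_card {N k : ℕ} {α : Type*} [Fintype α] (f : (Fin k → Fin N) → α)
    (hf : Function.Surjective f)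
    (hfib : ∀ i j, f i = f j ↔ ∃ π : Equiv.Perm (Fin N), ⇑π ∘ i = j) :
    (Pik N k).rank = Fintype.card α := by
  have range_eq : LinearMap.range (Pik N k).mulVecLin =
      LinearMap.range (LinearMap.funLeft ℂ ℂ f) := by
    apply le_antisymm
    · rintro _ ⟨v, rfl⟩
      refine ⟨fun a => (Pik N k *ᵥ v) (Function.surjInv hf a), ?_⟩
      ext i
      obtain ⟨σ, hσ⟩ := (hfib i _).1 (Function.surjInv_eq hf (f i)).symm
      rw [LinearMap.funLeft_apply, Matrix.mulVecLin_apply, Pik_mulVec, Pik_mulVec, ← hσ]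
      congr 1
      exact Equiv.sum_comp (Equiv.mulRight σ) fun π : Equiv.Perm (Fin N) => v (⇑π ∘ i)
    · rintro _ ⟨w, rfl⟩
      refine ⟨LinearMap.funLeft ℂ ℂ f w, ?_⟩
      ext i
      have const (π : Equiv.Perm (Fin N)) : f (⇑π ∘ i) = f i := ((hfib _ _).2 ⟨π, rfl⟩).symm
      simp [Pik_mulVec, LinearMap.funLeft_apply, const, Fintype.card_perm, Nat.factorial_ne_zero]
  rw [Matrix.rank, range_eq,
    LinearMap.finrank_range_of_inj (LinearMap.funLeft_injective_of_surjective ℂ ℂ f hf),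
    Module.finrank_fintype_fun_eq_card]

theorem exists_perm_comp_eq_iff {α β : Type*} [Finite α] (i j : α → β) :
    (∃ π : Equiv.Perm β, ⇑π ∘ i = j) ↔ Setoid.ker i = Setoid.ker j := by
  constructor
  · rintro ⟨π, rfl⟩
    ext a b
    simp [Setoid.ker_def]
  · intro h
    have hj : ∀ a b, Setoid.ker i a b → j a = j b := fun a b hab => by rwa [h] at hab
    obtain ⟨π, hπ⟩ := Equiv.Perm.exists_extending_pair (Setoid.kerLift i)
      (Quotient.lift (s := Setoid.ker i) j hj) (Setoid.kerLift_injective i) (by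
        rintro ⟨a⟩ ⟨b⟩ hab
        refine Quotient.sound ?_
        change Setoid.ker i a b
        rw [h]
        exact hab)
    exact ⟨π, funext fun a => hπ (Quotient.mk (Setoid.ker i) a)⟩

open scoped Classical in
theorem Finpartition.ofSetoid_injective {α : Type*} [Fintype α] [DecidableEq α] :
    Function.Injective fun s : Setoid α => Finpartition.ofSetoid s := by
  intro s t h
  ext a b
  rw [← Finpartition.mem_part_ofSetoid_iff_rel, ← Finpartition.mem_part_ofSetoid_iff_rel]
  simp only at h
  rw [h]

open scoped Classical in
theorem Finpartition.card_parts_ofSetoid_ker_le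
    {α β : Type*} [Fintype α] [DecidableEq α] [Fintype β]
    (i : α → β) : (Finpartition.ofSetoid (Setoid.ker i)).parts.card ≤ Fintype.card β := by
  calc (Finpartition.ofSetoid (Setoid.ker i)).parts.card
      ≤ (Finset.univ.image fun b : β => Finset.univ.filter fun a => b = i a).card := by
        refine Finset.card_le_card fun p hp => ?_
        obtain ⟨a, -, rfl⟩ := Finset.mem_image.1 hp
        exact Finset.mem_image.2 ⟨i a, Finset.mem_univ _, rfl⟩
    _ ≤ Fintype.card β := Finset.card_image_le

open scoped Classical in
theorem Finpartition.exists_ofSetoid_ker_eq {α β : Type*} [Fintype α] [DecidableEq α] [Fintype β]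
    (P : Finpartition (Finset.univ : Finset α)) (hP : P.parts.card ≤ Fintype.card β) :
    ∃ i : α → β, Finpartition.ofSetoid (Setoid.ker i) = P := by
  obtain ⟨e⟩ : Nonempty (P.parts ↪ β) :=
    Function.Embedding.nonempty_of_card_le (by simpa using hP)
  refine ⟨fun a => e ⟨P.part a, P.part_mem.2 (Finset.mem_univ a)⟩, ?_⟩
  have fibre (a : α) : (Finset.univ.filter fun b => P.part a = P.part b) = P.part a := by
    ext b
    rw [P.mem_part_iff_part_eq_part (Finset.mem_univ b) (Finset.mem_univ a)]
    simp [eq_comm]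
  ext p
  simp only [Finpartition.ofSetoid, Finpartition.ofSetSetoid, Setoid.ker_def, Finset.mem_image,
    e.injective.eq_iff, Subtype.mk.injEq, fibre]
  constructor
  · rintro ⟨a, ha, rfl⟩
    exact P.part_mem.2 ha
  · intro hp
    obtain ⟨a, ha⟩ := P.nonempty_of_mem_parts hp
    exact ⟨a, Finset.mem_univ a, P.part_eq_of_mem hp ha⟩

/-- The rank of Π_k equals the number of partitions of {1,…,k} into at most N
nonempty blocks; in particular for N ≥ k it equals the Bell number B_k, the
total number of partitions of a k-element set. -/
theorem stmt10 (N k : ℕ) (hN : 1 ≤ N) (hk : 1 ≤ k) :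
    (Pik N k).rank =
      Nat.card {P : Finpartition (Finset.univ : Finset (Fin k)) // P.parts.card ≤ N} ∧
    (k ≤ N → (Pik N k).rank = Nat.card (Finpartition (Finset.univ : Finset (Fin k)))) := by
  classical
  have rank_eq : (Pik N k).rank =
      Nat.card {P : Finpartition (Finset.univ : Finset (Fin k)) // P.parts.card ≤ N} := by
    rw [Nat.card_eq_fintype_card]
    refine rank_Pik_eq_card (fun i => ⟨Finpartition.ofSetoid (Setoid.ker i),
      by simpa using Finpartition.card_parts_ofSetoid_ker_le i⟩) ?_ fun i j => ?_
    · rintro ⟨P, hP⟩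
      obtain ⟨i, hi⟩ := Finpartition.exists_ofSetoid_ker_eq (β := Fin N) P (by simpa using hP)
      exact ⟨i, Subtype.ext (by convert hi)⟩
    · rw [exists_perm_comp_eq_iff, ← Finpartition.ofSetoid_injective.eq_iff, Subtype.mk.injEq]
  refine ⟨rank_eq, fun hkN => rank_eq.trans (Nat.card_congr (Equiv.subtypeUnivEquiv fun P => ?_))⟩
  exact P.card_parts_le_card.trans (by simpa using hkN)

end
end

section
/- Let N ≥ k ≥ 1 and let μ be the normalized Haar probability measure on U(N). Then the rank of the N^{2k}×N^{2k} matrix T̂_k := ∫_{U(N)} U^{⊗k} ⊗ (U*)^{⊗k} dμ(U) equals k!. Equivalently, the twirling map T_k(M) := ∫_{U(N)} U^{⊗k} M (U†)^{⊗k} dμ(U) on N^k×N^k matrices, which is a projection, has exactly k! unit eigenvalues. -/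
open scoped Matrix BigOperators
open MeasureTheory

noncomputable section

instance matMeasurableSpace (N : ℕ) : MeasurableSpace (Matrix (Fin N) (Fin N) ℂ) :=
  (inferInstance : MeasurableSpace (Fin N → Fin N → ℂ))

/-- Entrywise complex conjugate of a matrix. -/
def conjMat {n m : Type*} (A : Matrix n m ℂ) : Matrix n m ℂ :=
  A.map (starRingEnd ℂ)

/-- T̂_k = ∫ U^{⊗k} ⊗ (U*)^{⊗k} dμ(U), defined entrywise. -/
def ThatGen (N k : ℕ) (μ : Measure (Matrix.unitaryGroup (Fin N) ℂ)) :
    Matrix ((Fin k → Fin N) × (Fin k → Fin N)) ((Fin k → Fin N) × (Fin k → Fin N)) ℂ :=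
  Matrix.of fun p q => ∫ U : Matrix.unitaryGroup (Fin N) ℂ,
    tensorPow (U : Matrix (Fin N) (Fin N) ℂ) k p.1 q.1 *
      tensorPow (conjMat (U : Matrix (Fin N) (Fin N) ℂ)) k p.2 q.2 ∂μ

section TensorPow

variable {n : Type*} [Fintype n] {k : ℕ}

lemma tensorPow_mul [DecidableEq n] (A B : Matrix n n ℂ) (k : ℕ) :
    tensorPow (A * B) k = tensorPow A k * tensorPow B k := by
  ext i j
  simp only [tensorPow, Matrix.of_apply, Matrix.mul_apply, Finset.prod_univ_sum,
    Fintype.piFinset_univ, Finset.prod_mul_distrib]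

lemma tensorPow_one [DecidableEq n] (k : ℕ) : tensorPow (1 : Matrix n n ℂ) k = 1 := by
  ext i j
  simp only [tensorPow, Matrix.of_apply, Matrix.one_apply, Fintype.prod_ite_zero, funext_iff,
    Finset.prod_const_one]

lemma tensorPow_conjTranspose (A : Matrix n n ℂ) (k : ℕ) :
    tensorPow Aᴴ k = (tensorPow A k)ᴴ := by
  ext i j
  simp [tensorPow, Matrix.conjTranspose_apply]

lemma tensorPow_conjMat (A : Matrix n n ℂ) (k : ℕ) :
    tensorPow (conjMat A) k = ((tensorPow A k)ᴴ)ᵀ := by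
  ext i j
  simp [tensorPow, conjMat, Matrix.conjTranspose_apply]

lemma tensorPow_diagonal [DecidableEq n] (d : n → ℂ) (k : ℕ) :
    tensorPow (Matrix.diagonal d) k = Matrix.diagonal fun i : Fin k → n => ∏ a, d (i a) := by
  ext i j
  simp only [tensorPow, Matrix.of_apply, Matrix.diagonal_apply, Fintype.prod_ite_zero, funext_iff]
  congr

/-- The matrices commuting with every `U^{⊗k}`, `U` unitary. -/
def unitaryCommutant (n : Type*) [Fintype n] [DecidableEq n] (k : ℕ) :
    Submodule ℂ (Matrix (Fin k → n) (Fin k → n) ℂ) where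
  carrier := {M | ∀ U ∈ Matrix.unitaryGroup n ℂ, tensorPow U k * M = M * tensorPow U k}
  add_mem' ha hb U hU := by rw [mul_add, add_mul, ha U hU, hb U hU]
  zero_mem' U _ := by simp
  smul_mem' c M hM U hU := by rw [Matrix.mul_smul, Matrix.smul_mul, hM U hU]

variable [DecidableEq n] {M : Matrix (Fin k → n) (Fin k → n) ℂ}

lemma card_fiber_eq_of_mem_unitaryCommutant (hM : M ∈ unitaryCommutant n k) {i j : Fin k → n}
    (hij : M i j ≠ 0) (c : n) :
    Fintype.card {a // i a = c} = Fintype.card {a // j a = c} := by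
  have hw := Complex.isPrimitiveRoot_exp (k + 1) k.succ_ne_zero
  set w := Complex.exp (2 * Real.pi * Complex.I / ((k + 1 : ℕ) : ℂ))
  have hnorm : ‖w‖ = 1 := hw.norm'_eq_one k.succ_ne_zero
  let d : n → ℂ := fun b => if b = c then w else 1
  have hU : Matrix.diagonal d ∈ Matrix.unitaryGroup n ℂ := by
    rw [Matrix.mem_unitaryGroup_iff, Matrix.star_eq_conjTranspose, Matrix.diagonal_conjTranspose,
      Matrix.diagonal_mul_diagonal, ← Matrix.diagonal_one]
    congr 1
    ext b
    by_cases hb : b = c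
    · simp [d, hb, Complex.mul_conj, Complex.normSq_eq_norm_sq, hnorm]
    · simp [d, hb]
  have hprod (l : Fin k → n) : ∏ a, d (l a) = w ^ Fintype.card {a // l a = c} := by
    simp [d, Finset.prod_ite, Fintype.card_subtype]
  have hcard (l : Fin k → n) : Fintype.card {a // l a = c} < k + 1 := by
    simpa [Nat.lt_succ_iff] using Fintype.card_subtype_le fun a => l a = c
  have h := congrFun (congrFun (hM _ hU) i) j
  rw [tensorPow_diagonal, Matrix.diagonal_mul, Matrix.mul_diagonal, mul_comm (M i j), hprod,
    hprod] at h
  exact hw.pow_inj (hcard i) (hcard j) (mul_right_cancel₀ hij h)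

lemma tensorPow_diagonal_comm_of_mem_unitaryCommutant (hM : M ∈ unitaryCommutant n k)
    (d : n → ℂ) :
    tensorPow (Matrix.diagonal d) k * M = M * tensorPow (Matrix.diagonal d) k := by
  ext i j
  rw [tensorPow_diagonal, Matrix.diagonal_mul, Matrix.mul_diagonal, mul_comm (M i j)]
  by_cases hij : M i j = 0
  · simp [hij]
  have hprod (l : Fin k → n) : ∏ a, d (l a) = ∏ c, d c ^ Fintype.card {a // l a = c} := by
    simp_rw [Fintype.card_subtype, ← Finset.prod_const]
    exact (Finset.prod_fiberwise' Finset.univ l d).symm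
  simp_rw [hprod, card_fiber_eq_of_mem_unitaryCommutant hM hij]

end TensorPow

lemma exists_diagonal_mul_unitary {N : ℕ} (f : Fin N → Fin N) :
    ∃ d : Fin N → ℂ, ∃ W ∈ Matrix.unitaryGroup (Fin N) ℂ,
      Matrix.diagonal d * W = Matrix.of fun b a => if f a = b then 1 else 0 := by
  let v : Fin N → EuclideanSpace ℂ (Fin N) :=
    fun b => WithLp.toLp 2 fun a => if f a = b then 1 else 0
  have hv : Pairwise fun b c => inner ℂ (v b) (v c) = 0 := by
    intro b c hbc
    simp only [v, PiLp.inner_apply]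
    refine Finset.sum_eq_zero fun a _ => ?_
    by_cases h : f a = b
    · simp [h, hbc]
    · simp [h]
  let B := InnerProductSpace.gramSchmidtOrthonormalBasis (𝕜 := ℂ) (by simp) v
  refine ⟨fun b => ‖v b‖, Matrix.of fun b a => B b a, ?_, ?_⟩
  · rw [Matrix.mem_unitaryGroup_iff]
    ext b c
    have h := orthonormal_iff_ite.1 B.orthonormal c b
    simp only [PiLp.inner_apply, RCLike.inner_apply] at h
    simpa [Matrix.mul_apply, Matrix.star_apply, Matrix.one_apply, eq_comm] using h
  · ext b a
    have h : (‖v b‖ : ℂ) * B b a = v b a := by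
      by_cases hb : v b = 0
      · simp [hb]
      · have hn : (‖v b‖ : ℂ) ≠ 0 := by simpa using hb
        simp only [B, InnerProductSpace.gramSchmidtOrthonormalBasis_apply_of_orthogonal _ hv hb]
        simp [hn]
    simpa [Matrix.diagonal_mul, v] using h

section Fin

variable {N k : ℕ} {M : Matrix (Fin k → Fin N) (Fin k → Fin N) ℂ}

lemma apply_comp_eq_zero_of_mem_unitaryCommutant (hM : M ∈ unitaryCommutant (Fin N) k)
    (f : Fin N → Fin N) {j : Fin k → Fin N} (hj : ∀ i, M i j = 0) (i : Fin k → Fin N) :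
    M i (f ∘ j) = 0 := by
  obtain ⟨d, W, hW, hX⟩ := exists_diagonal_mul_unitary f
  have hcomm : tensorPow (Matrix.diagonal d * W) k * M =
      M * tensorPow (Matrix.diagonal d * W) k := by
    rw [tensorPow_mul, mul_assoc, hM W hW, ← mul_assoc,
      tensorPow_diagonal_comm_of_mem_unitaryCommutant hM, mul_assoc]
  have hentry (l : Fin k → Fin N) :
      tensorPow (Matrix.diagonal d * W) k l j = if f ∘ j = l then 1 else 0 := by
    simp only [hX, tensorPow, Matrix.of_apply, Fintype.prod_ite_zero, funext_iff,
      Function.comp_apply, Finset.prod_const_one]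
  have h := congrFun (congrFun hcomm i) j
  simpa [Matrix.mul_apply, hj, hentry] using h.symm

lemma exists_perm_of_apply_ne_zero (hM : M ∈ unitaryCommutant (Fin N) k)
    {i j : Fin k → Fin N} (hj : Function.Injective j) (hij : M i j ≠ 0) :
    ∃ σ : Equiv.Perm (Fin k), i = j ∘ σ := by
  have hcard := card_fiber_eq_of_mem_unitaryCommutant hM hij
  have hex (a : Fin k) : ∃ b, i b = j a := by
    have : 0 < Fintype.card {b // i b = j a} := by
      rw [hcard]
      exact Fintype.card_pos_iff.2 ⟨⟨a, rfl⟩⟩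
    obtain ⟨b, hb⟩ := Fintype.card_pos_iff.1 this
    exact ⟨b, hb⟩
  choose τ hτ using hex
  have hτi : Function.Injective τ := fun a b hab => hj (by rw [← hτ a, ← hτ b, hab])
  let e := Equiv.ofBijective τ (Finite.injective_iff_bijective.1 hτi)
  refine ⟨e.symm, funext fun a => ?_⟩
  rw [Function.comp_apply, ← hτ]
  exact congrArg i (e.apply_symm_apply a).symm

/-- The matrix permuting the tensor factors by `σ`. -/
def permTensor (n : Type*) [DecidableEq n] {k : ℕ} (σ : Equiv.Perm (Fin k)) :
    Matrix (Fin k → n) (Fin k → n) ℂ :=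
  Matrix.of fun i j => if i = j ∘ σ then 1 else 0

lemma permTensor_mem_unitaryCommutant (n : Type*) [Fintype n] [DecidableEq n]
    (σ : Equiv.Perm (Fin k)) : permTensor n σ ∈ unitaryCommutant n k := by
  intro U _
  ext i l
  have h (j : Fin k → n) : i = j ∘ σ ↔ i ∘ σ.symm = j := (σ.comp_symm_eq j i).symm
  have h1 : (tensorPow U k * permTensor n σ) i l = tensorPow U k i (l ∘ σ) := by
    simp [permTensor, Matrix.mul_apply]
  have h2 : (permTensor n σ * tensorPow U k) i l = tensorPow U k (i ∘ σ.symm) l := by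
    simp [permTensor, Matrix.mul_apply, h]
  rw [h1, h2, tensorPow, Matrix.of_apply, Matrix.of_apply,
    ← Equiv.prod_comp σ fun a => U ((i ∘ σ.symm) a) (l a)]
  simp

/-- Evaluation on the orbit of an index `j` under permutations. -/
def permEval (n : Type*) [Fintype n] [DecidableEq n] {k : ℕ} (j : Fin k → n) :
    unitaryCommutant n k →ₗ[ℂ] (Equiv.Perm (Fin k) → ℂ) where
  toFun M σ := M.1 (j ∘ σ) j
  map_add' _ _ := rfl
  map_smul' _ _ := rfl

lemma permEval_injective {j : Fin k → Fin N} (hj : Function.Injective j) :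
    Function.Injective (permEval (Fin N) j) := by
  rw [← LinearMap.ker_eq_bot, LinearMap.ker_eq_bot']
  rintro ⟨M, hM⟩ h0
  have hcol (i : Fin k → Fin N) : M i j = 0 := by
    by_contra hij
    obtain ⟨σ, rfl⟩ := exists_perm_of_apply_ne_zero hM hj hij
    exact hij (congrFun h0 σ)
  ext i l
  have hl : Function.extend j l id ∘ j = l := funext fun a => hj.extend_apply l id a
  rw [← hl]
  exact apply_comp_eq_zero_of_mem_unitaryCommutant hM _ hcol i

lemma permEval_surjective {n : Type*} [Fintype n] [DecidableEq n] {j : Fin k → n}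
    (hj : Function.Injective j) : Function.Surjective (permEval n j) := by
  intro c
  refine ⟨∑ σ, c σ • ⟨permTensor n σ, permTensor_mem_unitaryCommutant n σ⟩, ?_⟩
  ext τ
  have h (σ : Equiv.Perm (Fin k)) : j ∘ τ = j ∘ σ ↔ τ = σ := by
    rw [hj.comp_left.eq_iff, DFunLike.coe_fn_eq]
  have hperm (σ : Equiv.Perm (Fin k)) :
      permEval n j ⟨permTensor n σ, permTensor_mem_unitaryCommutant n σ⟩ τ =
        if τ = σ then 1 else 0 := by
    simp only [← h]
    rfl
  simp only [map_sum, map_smul, Finset.sum_apply, Pi.smul_apply, hperm]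
  simp

lemma finrank_unitaryCommutant (hkN : k ≤ N) :
    Module.finrank ℂ (unitaryCommutant (Fin N) k) = k.factorial := by
  have hj := Fin.castLE_injective hkN
  rw [(LinearEquiv.ofBijective _ ⟨permEval_injective hj, permEval_surjective hj⟩).finrank_eq,
    Module.finrank_fintype_fun_eq_card, Fintype.card_perm, Fintype.card_fin]

end Fin

section Twirl

variable {N : ℕ}

open scoped Kronecker

/-- The matrix `U^{⊗k} ⊗ (U*)^{⊗k}`. -/
def twirlKernel (U : Matrix (Fin N) (Fin N) ℂ) (k : ℕ) :
    Matrix ((Fin k → Fin N) × (Fin k → Fin N)) ((Fin k → Fin N) × (Fin k → Fin N)) ℂ :=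
  tensorPow U k ⊗ₖ tensorPow (conjMat U) k

lemma twirlKernel_mul (U V : Matrix (Fin N) (Fin N) ℂ) (k : ℕ) :
    twirlKernel (U * V) k = twirlKernel U k * twirlKernel V k := by
  have h : conjMat (U * V) = conjMat U * conjMat V := Matrix.map_mul
  rw [twirlKernel, h, tensorPow_mul, tensorPow_mul, Matrix.mul_kronecker_mul]
  rfl

/-- Vectorization of matrices, by rows. -/
def rowVec (ι : Type*) : Matrix ι ι ℂ ≃ₗ[ℂ] (ι × ι → ℂ) :=
  (Matrix.ofLinearEquiv ℂ).symm ≪≫ₗ (LinearEquiv.curry ℂ ℂ ι ι).symm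

lemma twirlKernel_mulVec_rowVec (U : Matrix (Fin N) (Fin N) ℂ) {k : ℕ}
    (M : Matrix (Fin k → Fin N) (Fin k → Fin N) ℂ) :
    twirlKernel U k *ᵥ rowVec _ M = rowVec _ (tensorPow U k * M * (tensorPow U k)ᴴ) := by
  have h : rowVec _ M = Matrix.vec Mᵀ := rfl
  rw [h, twirlKernel, Matrix.kronecker_mulVec_vec, tensorPow_conjMat, ← Matrix.transpose_mul,
    ← Matrix.transpose_mul, ← mul_assoc]
  rfl

lemma rowVec_fixed_iff {k : ℕ} (M : Matrix (Fin k → Fin N) (Fin k → Fin N) ℂ) :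
    (∀ U : Matrix.unitaryGroup (Fin N) ℂ, twirlKernel U.1 k *ᵥ rowVec _ M = rowVec _ M) ↔
      M ∈ unitaryCommutant (Fin N) k := by
  have key (U : Matrix.unitaryGroup (Fin N) ℂ) :
      twirlKernel U.1 k *ᵥ rowVec _ M = rowVec _ M ↔
        tensorPow U.1 k * M = M * tensorPow U.1 k := by
    have h1 : (tensorPow U.1 k)ᴴ * tensorPow U.1 k = 1 := by
      rw [← tensorPow_conjTranspose, ← tensorPow_mul, ← Matrix.star_eq_conjTranspose,
        Matrix.mem_unitaryGroup_iff'.1 U.2, tensorPow_one]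
    have h2 : tensorPow U.1 k * (tensorPow U.1 k)ᴴ = 1 := mul_eq_one_comm.1 h1
    rw [twirlKernel_mulVec_rowVec, (rowVec _).injective.eq_iff]
    constructor <;> intro h
    · calc _ = tensorPow U.1 k * M * ((tensorPow U.1 k)ᴴ * tensorPow U.1 k) := by
            rw [h1, mul_one]
        _ = _ := by rw [← mul_assoc, h]
    · rw [h, mul_assoc, h2, mul_one]
  exact ⟨fun h U hU => (key ⟨U, hU⟩).1 (h ⟨U, hU⟩), fun h U => (key U).2 (h U.1 U.2)⟩

lemma norm_tensorPow_apply_le_one {U : Matrix (Fin N) (Fin N) ℂ}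
    (hU : ∀ a b, ‖U a b‖ ≤ 1) {k : ℕ} (i j : Fin k → Fin N) : ‖tensorPow U k i j‖ ≤ 1 := by
  rw [tensorPow, Matrix.of_apply, norm_prod]
  exact Finset.prod_le_one (fun _ _ => norm_nonneg _) fun _ _ => hU _ _

lemma measurable_unitaryGroup_apply (a b : Fin N) :
    Measurable fun U : Matrix.unitaryGroup (Fin N) ℂ => U.1 a b :=
  (measurable_pi_apply b).comp ((measurable_pi_apply a).comp measurable_subtype_coe)

lemma measurable_twirlKernel_apply {k : ℕ} (p q : (Fin k → Fin N) × (Fin k → Fin N)) :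
    Measurable fun U : Matrix.unitaryGroup (Fin N) ℂ => twirlKernel U.1 k p q := by
  have h := measurable_unitaryGroup_apply (N := N)
  simp only [twirlKernel, Matrix.kroneckerMap_apply, tensorPow, conjMat, Matrix.of_apply,
    Matrix.map_apply]
  refine (Finset.measurable_fun_prod _ fun a _ => h _ _).mul
    (Finset.measurable_fun_prod _ fun a _ => ?_)
  exact Complex.continuous_conj.measurable.comp (h _ _)

lemma measurable_unitaryGroup_mul_left (V : Matrix.unitaryGroup (Fin N) ℂ) :
    Measurable fun U : Matrix.unitaryGroup (Fin N) ℂ => V * U := by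
  refine Measurable.subtype_mk (f := fun U : Matrix.unitaryGroup (Fin N) ℂ => V.1 * U.1) ?_
  refine measurable_pi_lambda _ fun a => measurable_pi_lambda _ fun b => ?_
  simp only [Matrix.mul_apply]
  exact Finset.measurable_fun_sum _ fun c _ => (measurable_unitaryGroup_apply c b).const_mul _

variable (k : ℕ) (μ : Measure (Matrix.unitaryGroup (Fin N) ℂ)) [IsProbabilityMeasure μ]

lemma integrable_twirlKernel_apply (p q : (Fin k → Fin N) × (Fin k → Fin N)) :
    Integrable (fun U : Matrix.unitaryGroup (Fin N) ℂ => twirlKernel U.1 k p q) μ := by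
  refine Integrable.of_bound (measurable_twirlKernel_apply p q).aestronglyMeasurable 1
    (Filter.Eventually.of_forall fun U => ?_)
  have hU := entry_norm_bound_of_unitary U.2
  rw [twirlKernel, Matrix.kroneckerMap_apply, norm_mul]
  refine mul_le_one₀ (norm_tensorPow_apply_le_one hU _ _) (norm_nonneg _)
    (norm_tensorPow_apply_le_one (fun a b => ?_) _ _)
  simpa [conjMat] using hU a b

lemma ThatGen_mulVec_of_fixed {v : (Fin k → Fin N) × (Fin k → Fin N) → ℂ}
    (hv : ∀ U : Matrix.unitaryGroup (Fin N) ℂ, twirlKernel U.1 k *ᵥ v = v) :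
    ThatGen N k μ *ᵥ v = v := by
  ext p
  calc (ThatGen N k μ *ᵥ v) p
      = ∑ q, (∫ U : Matrix.unitaryGroup (Fin N) ℂ, twirlKernel U.1 k p q ∂μ) * v q := rfl
    _ = ∫ U : Matrix.unitaryGroup (Fin N) ℂ, (twirlKernel U.1 k *ᵥ v) p ∂μ := by
        simp_rw [← integral_mul_const]
        rw [← integral_finsetSum _ fun q _ =>
          (integrable_twirlKernel_apply k μ p q).mul_const _]
        rfl
    _ = v p := by simp [hv]

lemma twirlKernel_mul_ThatGen (V : Matrix.unitaryGroup (Fin N) ℂ)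
    (hinv : μ.map (fun U => V * U) = μ) :
    twirlKernel V.1 k * ThatGen N k μ = ThatGen N k μ := by
  ext p q
  calc (twirlKernel V.1 k * ThatGen N k μ) p q
      = ∑ r, twirlKernel V.1 k p r *
          (∫ U : Matrix.unitaryGroup (Fin N) ℂ, twirlKernel U.1 k r q ∂μ) := rfl
    _ = ∫ U : Matrix.unitaryGroup (Fin N) ℂ, (twirlKernel V.1 k * twirlKernel U.1 k) p q ∂μ := by
        simp_rw [← integral_const_mul]
        rw [← integral_finsetSum _ fun r _ =>
          (integrable_twirlKernel_apply k μ r q).const_mul _]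
        rfl
    _ = ∫ U : Matrix.unitaryGroup (Fin N) ℂ, twirlKernel (V * U).1 k p q ∂μ := by
        refine integral_congr_ae (Filter.Eventually.of_forall fun U => ?_)
        exact congrFun (congrFun (twirlKernel_mul V.1 U.1 k).symm p) q
    _ = ∫ U : Matrix.unitaryGroup (Fin N) ℂ, twirlKernel U.1 k p q
          ∂(μ.map fun U => V * U) :=
        (integral_map (measurable_unitaryGroup_mul_left V).aemeasurable
          (measurable_twirlKernel_apply p q).aestronglyMeasurable).symm
    _ = ThatGen N k μ p q := by rw [hinv]; rfl

lemma range_ThatGen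
    (hinv : ∀ V : Matrix.unitaryGroup (Fin N) ℂ, μ.map (fun U => V * U) = μ) :
    LinearMap.range (ThatGen N k μ).mulVecLin =
      (unitaryCommutant (Fin N) k).map (rowVec (Fin k → Fin N)).toLinearMap := by
  ext v
  obtain ⟨M, rfl⟩ := (rowVec (Fin k → Fin N)).surjective v
  rw [Submodule.mem_map_equiv, LinearEquiv.symm_apply_apply,
    ← rowVec_fixed_iff]
  constructor
  · rintro ⟨w, hw⟩ U
    rw [← hw, Matrix.mulVecLin_apply, Matrix.mulVec_mulVec, twirlKernel_mul_ThatGen k μ U (hinv U)]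
  · exact fun h => ⟨_, ThatGen_mulVec_of_fixed k μ h⟩

end Twirl

/-- For N ≥ k the twirling projection T̂_k has rank exactly k!. -/
theorem stmt13 (N k : ℕ) (hk : 1 ≤ k) (hkN : k ≤ N)
    (μ : Measure (Matrix.unitaryGroup (Fin N) ℂ)) [IsProbabilityMeasure μ]
    (hinv : ∀ V : Matrix.unitaryGroup (Fin N) ℂ, μ.map (fun U => V * U) = μ) :
    (ThatGen N k μ).rank = k.factorial := by
  rw [Matrix.rank, range_ThatGen k μ hinv, LinearEquiv.finrank_map_eq,
    finrank_unitaryCommutant hkN]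

end
end

section
/- Let G be a finite group, D ≥ 1, and g₁,…,g_D ∈ G. For g ∈ G let P(g) be the |G|×|G| permutation matrix of left multiplication, P(g)e_h = e_{gh}, where (e_h)_{h∈G} is the standard basis of ℂ^G. For each a ∈ G define v_a := ∑_{h∈G} e_h ⊗ e_{ha} ∈ ℂ^G ⊗ ℂ^G. Then: (1) ((1/D)∑_{s=1}^D P(g_s)⊗P(g_s)) v_a = v_a for every a ∈ G; and (2) the family (v_a)_{a∈G} is linearly independent. Consequently the eigenvalue-1 eigenspace of (1/D)∑_{s=1}^D P(g_s)⊗P(g_s) has dimension at least |G|, so when |G| > 2 the generators of a Cayley graph never form a 2-copy classical tensor product expander. -/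
open scoped Kronecker Matrix BigOperators

noncomputable section

/-- The permutation matrix of left multiplication by g on ℂ^G:
P(g) e_h = e_{gh}, i.e. entry (i,h) is 1 iff i = g·h. -/
def cayleyMat (G : Type*) [Group G] [Fintype G] [DecidableEq G] (g : G) :
    Matrix G G ℂ :=
  Matrix.of fun i j => if g * j = i then 1 else 0

/-- The vector v_a = ∑_{h ∈ G} e_h ⊗ e_{ha} in ℂ^G ⊗ ℂ^G. -/
def cayleyVec (G : Type*) [Group G] [Fintype G] [DecidableEq G] (a : G) :
    G × G → ℂ :=
  fun p => if p.2 = p.1 * a then 1 else 0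

theorem kronecker_cayleyMat_mulVec (G : Type*) [Group G] [Fintype G] [DecidableEq G]
    (g : G) (v : G × G → ℂ) (p : G × G) :
    ((cayleyMat G g ⊗ₖ cayleyMat G g) *ᵥ v) p = v (g⁻¹ * p.1, g⁻¹ * p.2) := by
  rw [Matrix.mulVec, dotProduct, Finset.sum_eq_single (g⁻¹ * p.1, g⁻¹ * p.2)]
  · simp [cayleyMat, Matrix.kroneckerMap_apply]
  · rintro ⟨k, l⟩ - h
    have hkl : ¬(g * l = p.2 ∧ g * k = p.1) := by
      rintro ⟨hl, hk⟩
      exact h (by simp [← hk, ← hl])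
    simp [cayleyMat, Matrix.kroneckerMap_apply, ← ite_and, hkl]
  · simp

theorem kronecker_cayleyMat_mulVec_cayleyVec (G : Type*) [Group G] [Fintype G] [DecidableEq G]
    (g a : G) : (cayleyMat G g ⊗ₖ cayleyMat G g) *ᵥ cayleyVec G a = cayleyVec G a := by
  ext p
  rw [kronecker_cayleyMat_mulVec]
  simp [cayleyVec, mul_assoc]

theorem average_mulVec_cayleyVec (G : Type*) [Group G] [Fintype G] [DecidableEq G]
    (D : ℕ) (hD : 1 ≤ D) (g : Fin D → G) (a : G) :
    ((D : ℂ)⁻¹ • ∑ s, cayleyMat G (g s) ⊗ₖ cayleyMat G (g s)) *ᵥ cayleyVec G a =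
      cayleyVec G a := by
  have hD0 : (D : ℂ) ≠ 0 := by exact_mod_cast Nat.one_le_iff_ne_zero.mp hD
  rw [Matrix.smul_mulVec, Matrix.sum_mulVec]
  simp only [kronecker_cayleyMat_mulVec_cayleyVec, Finset.sum_const, Finset.card_univ,
    Fintype.card_fin]
  rw [← Nat.cast_smul_eq_nsmul ℂ, inv_smul_smul₀ hD0]

theorem linearIndependent_cayleyVec (G : Type*) [Group G] [Fintype G] [DecidableEq G] :
    LinearIndependent ℂ (cayleyVec G) := by
  rw [Fintype.linearIndependent_iff]
  intro c hc a
  simpa [cayleyVec] using congrFun hc (1, a)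

/-- Cayley graphs are never 2-copy tensor product expanders: each v_a is fixed
by (1/D)∑ₛ P(gₛ)⊗P(gₛ), the family (v_a) is linearly independent, and hence the
unit eigenspace has dimension at least |G|. -/
theorem stmt17 (G : Type*) [Group G] [Fintype G] [DecidableEq G]
    (D : ℕ) (hD : 1 ≤ D) (g : Fin D → G) :
    (∀ a : G,
      ((D : ℂ)⁻¹ • ∑ s, cayleyMat G (g s) ⊗ₖ cayleyMat G (g s)).mulVec (cayleyVec G a) =
        cayleyVec G a) ∧
    LinearIndependent ℂ (cayleyVec G) ∧
    Fintype.card G ≤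
      Module.finrank ℂ
        (Module.End.eigenspace
          (Matrix.toLin' ((D : ℂ)⁻¹ • ∑ s, cayleyMat G (g s) ⊗ₖ cayleyMat G (g s))) 1) := by
  refine ⟨average_mulVec_cayleyVec G D hD g, linearIndependent_cayleyVec G, ?_⟩
  rw [← finrank_span_eq_card (linearIndependent_cayleyVec G)]
  refine Submodule.finrank_mono (Submodule.span_le.mpr ?_)
  rintro _ ⟨a, rfl⟩
  rw [SetLike.mem_coe, Module.End.mem_eigenspace_iff, Matrix.toLin'_apply, one_smul]
  exact average_mulVec_cayleyVec G D hD g a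

end
end
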